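/- arXiv:2209.03325 — 8 statements merged into one kernel-verified Lean document; each statement's English description precedes it below -/
import Mathlib

section
/- Let G be a graph on n vertices and let 0 < γ < 1/2. Then there exist vertices v₁, v₂, …, v_r of G and pairwise disjoint sets U₁, U₂, …, U_r ⊆ V(G) such that: (1) v_j ∈ U_j for all j, and |U₁ ∪ ⋯ ∪ U_r| ≥ (1−γ)n; (2) every vertex u ∈ U_j satisfies dist(v_j, u) ≤ log n / log(1+γ), where dist denotes graph distance in G; (3) there is no edge of G between U_j and U_{j'} for any j ≠ j'. -/
open SimpleGraph Finset

/-- `G` contains a cycle of length `ℓ`. -/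
def HasCycleLength {V : Type} (G : SimpleGraph V) (ℓ : ℕ) : Prop :=
  ∃ (v : V) (c : G.Walk v v), c.IsCycle ∧ c.length = ℓ

/-- `G` is Hamiltonian: it contains a cycle passing through all vertices. -/
def IsHamiltonianGraph {V : Type} (G : SimpleGraph V) : Prop :=
  ∃ (v : V) (c : G.Walk v v), c.IsCycle ∧ ∀ u : V, u ∈ c.support

/-- The independence number of `G` is at most `k`. -/
def IndepNumLE {V : Type} (G : SimpleGraph V) (k : ℕ) : Prop :=
  ∀ s : Finset V, (∀ x ∈ s, ∀ y ∈ s, x ≠ y → ¬ G.Adj x y) → s.card ≤ k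

/-- `G` is pancyclic: it contains cycles of every length from `3` to `|V(G)|`. -/
def Pancyclic {V : Type} [Fintype V] (G : SimpleGraph V) : Prop :=
  ∀ ℓ : ℕ, 3 ≤ ℓ → ℓ ≤ Fintype.card V → HasCycleLength G ℓ

open Classical in
/-- BFS balls inside `S`. -/
noncomputable def bfsBall {V : Type} (G : SimpleGraph V) (S : Finset V) (v : V) : ℕ → Finset V
  | 0 => {v}
  | k + 1 => bfsBall G S v k ∪ S.filter (fun x => ∃ y ∈ bfsBall G S v k, G.Adj y x)

theorem bfsBall_walk {V : Type} (G : SimpleGraph V) (S : Finset V) (v : V) (k : ℕ) :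
    ∀ u ∈ bfsBall G S v k, ∃ w : G.Walk v u, w.length ≤ k := by
  classical
  induction k with
  | zero =>
    intro u hu
    simp only [bfsBall, Finset.mem_singleton] at hu
    subst hu
    exact ⟨Walk.nil, by simp⟩
  | succ k ih =>
    intro u hu
    simp only [bfsBall, Finset.mem_union, Finset.mem_filter] at hu
    rcases hu with hu | ⟨_, y, hy, hyu⟩
    · obtain ⟨w, hw⟩ := ih u hu
      exact ⟨w, by omega⟩
    · obtain ⟨w, hw⟩ := ih y hy
      exact ⟨w.concat hyu, by simp [Walk.length_concat, hw]⟩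

theorem bfsBall_subset {V : Type} (G : SimpleGraph V) (S : Finset V) (v : V) (hv : v ∈ S)
    (k : ℕ) : bfsBall G S v k ⊆ S := by
  classical
  induction k with
  | zero => simpa [bfsBall] using hv
  | succ k ih => exact Finset.union_subset ih (Finset.filter_subset _ _)

theorem mem_bfsBall {V : Type} (G : SimpleGraph V) (S : Finset V) (v : V)
    (k : ℕ) : v ∈ bfsBall G S v k := by
  classical
  induction k with
  | zero => simp [bfsBall]
  | succ k ih => exact Finset.mem_union_left _ ih

theorem bfsBall_mono {V : Type} (G : SimpleGraph V) (S : Finset V) (v : V) (k : ℕ) :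
    bfsBall G S v k ⊆ bfsBall G S v (k+1) := by
  classical
  exact Finset.subset_union_left

theorem bfsBall_adj {V : Type} (G : SimpleGraph V) (S : Finset V) (v : V) (k : ℕ) (x y : V)
    (hx : x ∈ bfsBall G S v k) (hy : y ∈ S) (h : G.Adj x y) : y ∈ bfsBall G S v (k+1) := by
  classical
  exact Finset.mem_union_right _ (Finset.mem_filter.mpr ⟨hy, x, hx, h⟩)

theorem bfs_step (V : Type) [Fintype V] [DecidableEq V] (G : SimpleGraph V)
    (γ : ℝ) (hγ : 0 < γ) (S : Finset V) (v : V) (hv : v ∈ S) :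
    ∃ B C : Finset V, v ∈ B ∧ B ⊆ C ∧ C ⊆ S ∧ (C.card : ℝ) ≤ (1 + γ) * B.card ∧
      (∀ u ∈ B, (G.dist v u : ℝ) ≤ Real.log (Fintype.card V) / Real.log (1 + γ)) ∧
      (∀ x ∈ B, ∀ y ∈ S \ C, ¬ G.Adj x y) := by
  classical
  have key : ∀ k, (∀ i < k, ¬ ((bfsBall G S v (i+1)).card : ℝ) ≤ (1 + γ) * (bfsBall G S v i).card)
      → (1 + γ) ^ k ≤ ((bfsBall G S v k).card : ℝ) := by
    intro k
    induction k with
    | zero => intro _; simp [bfsBall]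
    | succ k ih =>
      intro h
      have h1 := ih (fun i hi => h i (by omega))
      have h2 := h k (by omega)
      rw [pow_succ]
      nlinarith
  have hle : ∀ k, ((bfsBall G S v k).card : ℝ) ≤ Fintype.card V := fun k => by
    exact_mod_cast Finset.card_le_univ _
  have hex : ∃ k, ((bfsBall G S v (k+1)).card : ℝ) ≤ (1 + γ) * (bfsBall G S v k).card := by
    by_contra hne
    push Not at hne
    obtain ⟨k, hk⟩ := pow_unbounded_of_one_lt (Fintype.card V : ℝ) (by linarith : 1 < 1 + γ)
    have := key k (fun i _ => not_le.mpr (hne i))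
    linarith [hle k]
  have hk := Nat.find_spec hex
  have hpow := (key (Nat.find hex) (fun i hi => Nat.find_min hex hi)).trans (hle _)
  set k := Nat.find hex
  refine ⟨bfsBall G S v k, bfsBall G S v (k+1), mem_bfsBall .., bfsBall_mono ..,
    bfsBall_subset G S v hv _, hk, ?_, ?_⟩
  · intro u hu
    obtain ⟨w, hw⟩ := bfsBall_walk G S v k u hu
    have h1 : (G.dist v u : ℝ) ≤ k := by exact_mod_cast (dist_le w).trans hw
    refine h1.trans ?_
    rw [le_div_iff₀ (Real.log_pos (by linarith)), ← Real.log_pow]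
    exact Real.log_le_log (by positivity) hpow
  · intro x hx y hy hxy
    rw [Finset.mem_sdiff] at hy
    exact hy.2 (bfsBall_adj G S v k x y hx hy.1 hxy)

theorem bfs_main (V : Type) [Fintype V] [DecidableEq V] (G : SimpleGraph V)
    (γ : ℝ) (hγ : 0 < γ) (hγ' : γ < 1 / 2) (S : Finset V) :
    ∃ (r : ℕ) (v : Fin r → V) (U : Fin r → Finset V),
      (∀ j, U j ⊆ S) ∧
      (∀ i j : Fin r, i ≠ j → Disjoint (U i) (U j)) ∧
      (∀ j : Fin r, v j ∈ U j) ∧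
      (1 - γ) * (S.card : ℝ) ≤ ∑ j, ((U j).card : ℝ) ∧
      (∀ j : Fin r, ∀ u ∈ U j,
        (G.dist (v j) u : ℝ) ≤ Real.log (Fintype.card V) / Real.log (1 + γ)) ∧
      (∀ i j : Fin r, i ≠ j → ∀ x ∈ U i, ∀ y ∈ U j, ¬ G.Adj x y) := by
  induction S using Finset.strongInduction with
  | H S ih =>
    rcases S.eq_empty_or_nonempty with rfl | ⟨v₀, hv₀⟩
    · exact ⟨0, Fin.elim0, Fin.elim0, fun j => j.elim0, fun j => j.elim0, fun j => j.elim0,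
        by simp, fun j => j.elim0, fun j => j.elim0⟩
    obtain ⟨B, C, hvB, hBC, hCS, hcard, hdist, hadj⟩ := bfs_step V G γ hγ S v₀ hv₀
    obtain ⟨r, v, U, hS, hd, hm, hc, hD, hA⟩ := ih (S \ C)
      (Finset.sdiff_ssubset hCS ⟨v₀, hBC hvB⟩)
    have hdj : ∀ j, Disjoint B (U j) := fun j =>
      Finset.disjoint_left.mpr fun x hx hx' => (Finset.mem_sdiff.mp (hS j hx')).2 (hBC hx)
    refine ⟨r + 1, Fin.cons v₀ v, Fin.cons B U, ?_, ?_, ?_, ?_, ?_, ?_⟩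
    · intro j
      refine Fin.cases ?_ (fun j => ?_) j
      · exact hBC.trans hCS
      · exact (hS j).trans Finset.sdiff_subset
    · intro i j
      refine Fin.cases ?_ (fun i => ?_) i <;> refine Fin.cases ?_ (fun j => ?_) j
      · intro h; exact absurd rfl h
      · intro _; exact hdj j
      · intro _; exact (hdj i).symm
      · intro h; exact hd i j (fun e => h (by rw [e]))
    · intro j
      refine Fin.cases ?_ (fun j => ?_) j
      · exact hvB
      · exact hm j
    · rw [Fin.sum_univ_succ]
      simp only [Fin.cons_zero, Fin.cons_succ]
      have h1 : (S.card : ℝ) = (S \ C).card + C.card := by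
        exact_mod_cast (Finset.card_sdiff_add_card_eq_card hCS).symm
      have h2 : (0 : ℝ) ≤ B.card := by positivity
      have h3 : (1 - γ) * (C.card : ℝ) ≤ (1 - γ) * ((1 + γ) * B.card) :=
        mul_le_mul_of_nonneg_left hcard (by linarith)
      have h4 : 0 ≤ γ ^ 2 * (B.card : ℝ) := by positivity
      rw [h1]
      nlinarith
    · intro j
      refine Fin.cases ?_ (fun j => ?_) j
      · exact hdist
      · exact hD j
    · intro i j
      refine Fin.cases ?_ (fun i => ?_) i <;> refine Fin.cases ?_ (fun j => ?_) j
      · intro h; exact absurd rfl h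
      · intro _ x hx y hy; exact hadj x hx y (hS j hy)
      · intro _ x hx y hy h; exact hadj y hy x (hS i hx) h.symm
      · intro h; exact hA i j (fun e => h (by rw [e]))

/-- BFS partition lemma: a (1-γ)-fraction of the vertices can be partitioned into
low-diameter pieces with no edges between them. -/
theorem stmt2 (V : Type) [Fintype V] [DecidableEq V] (G : SimpleGraph V)
    (γ : ℝ) (hγ : 0 < γ) (hγ' : γ < 1 / 2) :
    ∃ (r : ℕ) (v : Fin r → V) (U : Fin r → Finset V),
      (∀ i j : Fin r, i ≠ j → Disjoint (U i) (U j)) ∧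
      (∀ j : Fin r, v j ∈ U j) ∧
      (1 - γ) * (Fintype.card V : ℝ) ≤ ((Finset.univ.biUnion U).card : ℝ) ∧
      (∀ j : Fin r, ∀ u ∈ U j,
        (G.dist (v j) u : ℝ) ≤ Real.log (Fintype.card V) / Real.log (1 + γ)) ∧
      (∀ i j : Fin r, i ≠ j → ∀ x ∈ U i, ∀ y ∈ U j, ¬ G.Adj x y) := by
  obtain ⟨r, v, U, _, hd, hm, hc, hD, hA⟩ := bfs_main V G γ hγ hγ' Finset.univ
  refine ⟨r, v, U, hd, hm, ?_, hD, hA⟩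
  rw [Finset.card_biUnion (fun i _ j _ h => hd i j h)]
  push_cast
  simpa using hc
end

section
/- Let G be a graph on n vertices with independence number α(G) ≤ k (k a positive integer) and let 0 < γ < 1/2. Then there exist two vertices u, v ∈ V(G) such that for every integer ℓ with log n / log(1+γ) ≤ ℓ ≤ (1−γ)·n/k, the graph G contains a path of length ℓ whose endpoints are u and v. -/
open SimpleGraph Finset

/-- Balls inside the induced graph on `W`. -/
def sBall {V : Type} (G : SimpleGraph V) (W : Set V) (u : V) : ℕ → Set V
  | 0 => {u}
  | i + 1 => sBall G W u i ∪ {w | w ∈ W ∧ ∃ x ∈ sBall G W u i, G.Adj x w}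

lemma sBall_mono {V : Type} (G : SimpleGraph V) (W : Set V) (u : V) : Monotone (sBall G W u) :=
  monotone_nat_of_le_succ fun _ => Set.subset_union_left

lemma sBall_sub {V : Type} (G : SimpleGraph V) (W : Set V) (u : V) (hu : u ∈ W) (i : ℕ) :
    sBall G W u i ⊆ W := by
  induction i with
  | zero => simpa [sBall] using hu
  | succ i ih =>
    rintro x (hx | hx)
    · exact ih hx
    · exact hx.1

def Chn {V : Type} (G : SimpleGraph V) (B : Set V) (f : V → ℕ) : ℕ → V → Prop
  | 0, v => v ∈ B
  | j + 1, v => v ∈ B ∧ ∃ v', Chn G B f j v' ∧ G.Adj v' v ∧ f v' < f v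

lemma Chn_mem {V : Type} (G : SimpleGraph V) (B : Set V) (f : V → ℕ) (j : ℕ) (v : V)
    (h : Chn G B f j v) : v ∈ B := by
  cases j with
  | zero => exact h
  | succ j => exact h.1

/-- path extension -/
lemma path_ext {V : Type} (G : SimpleGraph V) (f : V → ℕ) (u x w : V) (ℓ : ℕ)
    (h : ∃ p : G.Walk u x, p.IsPath ∧ p.length = ℓ ∧ ∀ y ∈ p.support, f y ≤ f x)
    (ha : G.Adj x w) (hf : f x < f w) :
    ∃ p : G.Walk u w, p.IsPath ∧ p.length = ℓ + 1 ∧ ∀ y ∈ p.support, f y ≤ f w := by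
  obtain ⟨p, hp, hl, hs⟩ := h
  refine ⟨p.concat ha, ?_, ?_, ?_⟩
  · refine hp.concat ?_ ha
    intro hw
    have := hs _ hw
    omega
  · simp [hl]
  · intro y hy
    rw [SimpleGraph.Walk.support_concat] at hy
    simp at hy
    rcases hy with hy | rfl
    · exact (hs y hy).trans hf.le
    · exact le_rfl

lemma ball_alt {V : Type} [Fintype V] (G : SimpleGraph V) (W : Set V) (u : V) (M r : ℕ) :
    (∃ v : V, ∀ ℓ : ℕ, r ≤ ℓ → ℓ ≤ M → ∃ p : G.Walk u v, p.IsPath ∧ p.length = ℓ) ∨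
    ∃ I : Finset V, (∀ x ∈ I, x ∈ sBall G W u r) ∧
      (∀ x ∈ I, ∀ y ∈ I, x ≠ y → ¬ G.Adj x y) ∧ (sBall G W u r).ncard ≤ M * I.card := by
  classical
  set B := sBall G W u r with hB
  set n := Fintype.card V
  let e := Fintype.equivFin V
  let d : V → ℕ := fun w => sInf {i | w ∈ sBall G W u i}
  let f : V → ℕ := fun w => d w * n + e w
  have he : ∀ w, (e w : ℕ) < n := fun w => (e w).2
  have hfd : ∀ w w', d w < d w' → f w < f w' := by
    intro w w' h
    have h1 := he w
    have : (d w + 1) * n ≤ d w' * n := Nat.mul_le_mul_right _ h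
    simp only [f]
    rw [add_mul] at this
    omega
  have hfd' : ∀ w w', f w < f w' → d w ≤ d w' := by
    intro w w' h
    by_contra hc
    have := hfd w' w (by omega)
    omega
  have hfi : ∀ w w', f w = f w' → w = w' := by
    intro w w' h
    have hd : d w = d w' := by
      rcases lt_trichotomy (d w) (d w') with h1 | h1 | h1
      · have := hfd _ _ h1; omega
      · exact h1
      · have := hfd _ _ h1; omega
    simp only [f, hd] at h
    apply e.injective
    apply Fin.ext
    omega
  have hdle : ∀ w i, w ∈ sBall G W u i → d w ≤ i := fun w i h => Nat.sInf_le h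
  have hdmem : ∀ w i, w ∈ sBall G W u i → w ∈ sBall G W u (d w) := fun w i h =>
    Nat.sInf_mem (s := {i | w ∈ sBall G W u i}) ⟨i, h⟩
  -- BFS paths
  have hbfs : ∀ j w, w ∈ sBall G W u j → d w = j →
      ∃ p : G.Walk u w, p.IsPath ∧ p.length = j ∧ ∀ y ∈ p.support, f y ≤ f w := by
    intro j
    induction j with
    | zero =>
      intro w hw _
      have : w = u := hw
      subst this
      exact ⟨.nil, by simp, by simp, by simp⟩
    | succ j ih =>
      intro w hw hd
      rcases hw with hw | ⟨hwW, x, hx, hxw⟩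
      · have := hdle _ _ hw; omega
      · have h1 := hdle _ _ hx
        have h2 : w ∈ sBall G W u (d x + 1) := Or.inr ⟨hwW, x, hdmem _ _ hx, hxw⟩
        have h3 := hdle _ _ h2
        have h4 : d x = j := by omega
        exact path_ext G f u x w j (ih x hx h4) hxw (hfd _ _ (by omega))
  have hpath : ∀ ℓ j v, Chn G B f j v → d v ≤ ℓ → ℓ ≤ j →
      ∃ p : G.Walk u v, p.IsPath ∧ p.length = ℓ ∧ ∀ y ∈ p.support, f y ≤ f v := by
    intro ℓ
    induction ℓ with
    | zero =>
      intro j v hc h1 h2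
      have hm := hdmem v r (Chn_mem _ _ _ _ _ hc)
      have h0 : d v = 0 := by omega
      rw [h0] at hm
      exact hbfs 0 v hm h0
    | succ ℓ ih =>
      intro j v hc h1 h2
      have hm := hdmem v r (Chn_mem _ _ _ _ _ hc)
      rcases h1.eq_or_lt with h1 | h1
      · rw [h1] at hm
        exact hbfs _ v hm h1
      · obtain ⟨j, rfl⟩ : ∃ i, j = i + 1 := ⟨j - 1, by omega⟩
        obtain ⟨_, v', hc', ha, hf⟩ := hc
        have := hfd' _ _ hf
        exact path_ext G f u v' v ℓ (ih j v' hc' (by omega) (by omega)) ha hf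
  by_cases hex : ∃ v, Chn G B f M v
  · left
    obtain ⟨v, hv⟩ := hex
    refine ⟨v, fun ℓ h1 h2 => ?_⟩
    have := hdle _ _ (Chn_mem _ _ _ _ _ hv)
    obtain ⟨p, hp, hl, _⟩ := hpath ℓ M v hv (by omega) h2
    exact ⟨p, hp, hl⟩
  · right
    push Not at hex
    let c : V → ℕ := fun v => Nat.findGreatest (fun j => Chn G B f j v) M
    have hcC : ∀ v ∈ B, Chn G B f (c v) v := fun v hv =>
      Nat.findGreatest_spec (P := fun j => Chn G B f j v) (Nat.zero_le M) hv
    have hcM : ∀ v ∈ B, c v < M := by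
      intro v hv
      refine lt_of_le_of_ne (Nat.findGreatest_le M) ?_
      intro h
      have := hcC v hv
      rw [h] at this
      exact hex v this
    have hcol : ∀ v ∈ B, ∀ w ∈ B, G.Adj v w → f v < f w → c v < c w := by
      intro v hv w hw ha hf
      have : Chn G B f (c v + 1) w := ⟨hw, v, hcC v hv, ha, hf⟩
      exact Nat.le_findGreatest (hcM v hv) this
    have hu : u ∈ B := sBall_mono G W u (Nat.zero_le r) rfl
    have hM : 0 < M := (Nat.zero_le _).trans_lt (hcM u hu)
    let Bf := B.toFinset
    obtain ⟨y, hy, hle⟩ := Finset.exists_le_card_fiber_of_nsmul_le_card_of_maps_to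
      (s := Bf) (t := Finset.range M) (f := c) (b := (Bf.card : ℚ) / M)
      (by intro a ha; simpa using hcM a (by simpa [Bf] using ha))
      ⟨0, by simpa using hM⟩
      (by
        have : (M : ℚ) ≠ 0 := by positivity
        simp; field_simp; rfl)
    refine ⟨Bf.filter (fun x => c x = y), ?_, ?_, ?_⟩
    · intro x hx
      simp [Bf] at hx
      exact hx.1
    · intro a ha b hb hab hadj
      simp [Bf] at ha hb
      rcases lt_trichotomy (f a) (f b) with h | h | h
      · have := hcol a ha.1 b hb.1 hadj h; omega
      · exact hab (hfi _ _ h)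
      · have := hcol b hb.1 a ha.1 hadj.symm h; omega
    · rw [div_le_iff₀ (by positivity)] at hle
      rw [Set.ncard_eq_toFinset_card' B, mul_comm]
      exact_mod_cast hle

lemma carve {V : Type} [Fintype V] (G : SimpleGraph V) (γ : ℝ) (hγ : 0 < γ) (M : ℕ)
    (hno : ∀ u v : V, ∃ ℓ : ℕ, Real.log (Fintype.card V) / Real.log (1 + γ) ≤ (ℓ : ℝ) ∧
      ℓ ≤ M ∧ ¬ ∃ p : G.Walk u v, p.IsPath ∧ p.length = ℓ) :
    ∀ (m : ℕ) (W : Set V), W.ncard = m → ∃ I : Finset V, (∀ x ∈ I, x ∈ W) ∧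
      (∀ x ∈ I, ∀ y ∈ I, x ≠ y → ¬ G.Adj x y) ∧ (W.ncard : ℝ) ≤ (1 + γ) * (M * I.card) := by
  classical
  intro m
  induction m using Nat.strong_induction_on with
  | _ m ih =>
  intro W hW
  rcases W.eq_empty_or_nonempty with rfl | ⟨u, hu⟩
  · exact ⟨∅, by simp, by simp, by simp⟩
  set B := sBall G W u with hB
  have hg : (1 : ℝ) < 1 + γ := by linarith
  have hex : ∃ r, ((B (r + 1)).ncard : ℝ) ≤ (1 + γ) * (B r).ncard := by
    by_contra hc
    push Not at hc
    have hgrow : ∀ i, (1 + γ) ^ i ≤ ((B i).ncard : ℝ) := by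
      intro i
      induction i with
      | zero => simp [B, sBall]
      | succ i ih' => rw [pow_succ']; nlinarith [hc i]
    obtain ⟨i, hi⟩ := pow_unbounded_of_one_lt (Fintype.card V : ℝ) hg
    have h1 : (B i).ncard ≤ Fintype.card V := by
      rw [← Nat.card_eq_fintype_card]; exact Set.ncard_le_card _
    have h2 : ((B i).ncard : ℝ) ≤ Fintype.card V := by exact_mod_cast h1
    linarith [hgrow i]
  let r := Nat.find hex
  have hr : ((B (r + 1)).ncard : ℝ) ≤ (1 + γ) * (B r).ncard := Nat.find_spec hex
  have hrmin : ∀ i < r, (1 + γ) * (B i).ncard < ((B (i + 1)).ncard : ℝ) := fun i hi =>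
    not_le.mp (Nat.find_min hex hi)
  have hgrow : ∀ i ≤ r, (1 + γ) ^ i ≤ ((B i).ncard : ℝ) := by
    intro i
    induction i with
    | zero => simp [B, sBall]
    | succ i ih' => intro hi; rw [pow_succ']; nlinarith [hrmin i (by omega), ih' (by omega)]
  have h1 : (B r).ncard ≤ Fintype.card V := by
    rw [← Nat.card_eq_fintype_card]; exact Set.ncard_le_card _
  have hrlog : (r : ℝ) ≤ Real.log (Fintype.card V) / Real.log (1 + γ) := by
    rw [le_div_iff₀ (Real.log_pos hg), ← Real.log_pow]
    apply Real.log_le_log (by positivity)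
    exact (hgrow r le_rfl).trans (by exact_mod_cast h1)
  rcases ball_alt G W u M r with ⟨v, hv⟩ | ⟨I, hI1, hI2, hI3⟩
  · obtain ⟨ℓ, hl1, hl2, hl3⟩ := hno u v
    exact absurd (hv ℓ (by exact_mod_cast hrlog.trans hl1) hl2) hl3
  have hsub : B (r + 1) ⊆ W := sBall_sub G W u hu _
  have huB : u ∈ B (r + 1) := sBall_mono G W u (Nat.zero_le _) rfl
  have hcard : (W \ B (r + 1)).ncard + (B (r + 1)).ncard = W.ncard :=
    Set.ncard_sdiff_add_ncard_of_subset hsub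
  have hpos : 0 < (B (r + 1)).ncard := (Set.ncard_pos).2 ⟨u, huB⟩
  obtain ⟨I', hI1', hI2', hI3'⟩ := ih _ (by omega) (W \ B (r + 1)) rfl
  have hBr : B r ⊆ B (r + 1) := sBall_mono G W u (Nat.le_succ r)
  have hcross : ∀ x ∈ I, ∀ y ∈ I', ¬ G.Adj x y := by
    intro x hx y hy ha
    exact (hI1' y hy).2 (Or.inr ⟨(hI1' y hy).1, x, hI1 x hx, ha⟩)
  have hdisj : Disjoint I I' := by
    rw [Finset.disjoint_left]
    intro x hx hx'
    exact (hI1' x hx').2 (hBr (hI1 x hx))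
  refine ⟨I ∪ I', ?_, ?_, ?_⟩
  · intro x hx
    rcases Finset.mem_union.1 hx with hx | hx
    · exact hsub (hBr (hI1 x hx))
    · exact (hI1' x hx).1
  · intro x hx y hy hxy
    rcases Finset.mem_union.1 hx with hx | hx <;> rcases Finset.mem_union.1 hy with hy | hy
    · exact hI2 x hx y hy hxy
    · exact hcross x hx y hy
    · exact fun h => hcross y hy x hx h.symm
    · exact hI2' x hx y hy hxy
  · rw [Finset.card_union_of_disjoint hdisj]
    have e1 : ((B r).ncard : ℝ) ≤ M * I.card := by exact_mod_cast hI3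
    have e2 : ((W \ B (r + 1)).ncard : ℝ) + (B (r + 1)).ncard = W.ncard := by
      exact_mod_cast hcard
    have e3 := mul_le_mul_of_nonneg_left e1 (by linarith : (0 : ℝ) ≤ 1 + γ)
    push_cast
    nlinarith

/-- In a graph with independence number at most k there are two vertices joined by
paths of every length in the interval [log n / log(1+γ), (1-γ)n/k]. -/
theorem stmt3 (V : Type) [Fintype V] [Nonempty V] (G : SimpleGraph V)
    (k : ℕ) (hk : 0 < k) (hindep : IndepNumLE G k)
    (γ : ℝ) (hγ : 0 < γ) (hγ' : γ < 1 / 2) :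
    ∃ u v : V, ∀ ℓ : ℕ,
      Real.log (Fintype.card V) / Real.log (1 + γ) ≤ (ℓ : ℝ) →
      (ℓ : ℝ) ≤ (1 - γ) * (Fintype.card V : ℝ) / (k : ℝ) →
      ∃ p : G.Walk u v, p.IsPath ∧ p.length = ℓ := by
  by_contra hcon
  push Not at hcon
  have hn : (0 : ℝ) < Fintype.card V := by exact_mod_cast Fintype.card_pos
  have hk' : (0 : ℝ) < k := by exact_mod_cast hk
  have hx : 0 ≤ (1 - γ) * (Fintype.card V : ℝ) / (k : ℝ) := by
    have : 0 ≤ 1 - γ := by linarith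
    positivity
  obtain ⟨I, _, hI, hc⟩ := carve G γ hγ ⌊(1 - γ) * (Fintype.card V : ℝ) / (k : ℝ)⌋₊
    (by
      intro u v
      obtain ⟨ℓ, h1, h2, h3⟩ := hcon u v
      refine ⟨ℓ, h1, Nat.le_floor h2, ?_⟩
      rintro ⟨p, hp, hl⟩
      exact h3 p hp hl) _ Set.univ rfl
  have hIk : (I.card : ℝ) ≤ k := by exact_mod_cast hindep I hI
  have hfl := Nat.floor_le hx
  rw [Set.ncard_univ, Nat.card_eq_fintype_card] at hc
  have h1 : (⌊(1 - γ) * (Fintype.card V : ℝ) / (k : ℝ)⌋₊ : ℝ) * I.card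
      ≤ (1 - γ) * (Fintype.card V : ℝ) / (k : ℝ) * k :=
    mul_le_mul hfl hIk (by positivity) hx
  rw [div_mul_cancel₀ _ hk'.ne'] at h1
  have h2 := mul_le_mul_of_nonneg_left h1 (by linarith : (0 : ℝ) ≤ 1 + γ)
  nlinarith [mul_pos (mul_pos hγ hγ) hn]
end

section
/- Let G be a graph with independence number at most k, and let P be a path in G with endpoints x and y such that the length |P| of P satisfies |P| > 2k. Then there is an xy-path P' in G with V(P') ⊆ V(P) and |P| − 2k ≤ |P'| < |P|. -/
open SimpleGraph Finset

/-- A path of length more than 2k in a graph with independence number at most k can be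
shortened, on the same endpoints and within the same vertex set, by at most 2k. -/
theorem stmt4 (V : Type) (G : SimpleGraph V) (k : ℕ) (hindep : IndepNumLE G k)
    (x y : V) (p : G.Walk x y) (hp : p.IsPath) (hlen : 2 * k < p.length) :
    ∃ q : G.Walk x y, q.IsPath ∧ (∀ w ∈ q.support, w ∈ p.support) ∧
      p.length - 2 * k ≤ q.length ∧ q.length < p.length := by
  have hinj : ∀ i ≤ p.length, ∀ j ≤ p.length, p.getVert i = p.getVert j → i = j := by
    intro i hi j hj h
    exact hp.getVert_injOn hi hj h
  have key : ∃ a b, a < b ∧ b ≤ 2 * k ∧ a + 2 ≤ b ∧ G.Adj (p.getVert a) (p.getVert b) := by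
    classical
    by_contra hcon
    push Not at hcon
    have hc := hindep ((Finset.range (k+1)).image (fun i => p.getVert (2 * i))) (by
      intro u hu v hv huv hadj
      simp only [Finset.mem_image, Finset.mem_range] at hu hv
      obtain ⟨i, hi, rfl⟩ := hu
      obtain ⟨j, hj, rfl⟩ := hv
      rcases lt_trichotomy i j with h | h | h
      · exact hcon (2*i) (2*j) (by omega) (by omega) (by omega) hadj
      · subst h; exact huv rfl
      · exact hcon (2*j) (2*i) (by omega) (by omega) (by omega) hadj.symm)
    rw [Finset.card_image_of_injOn, Finset.card_range] at hc
    · omega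
    · intro i hi j hj h
      simp only [Finset.coe_range, Set.mem_Iio] at hi hj
      have := hinj _ (by omega) _ (by omega) h
      omega
  obtain ⟨a, b, hab, hb, hab2, hadj⟩ := key
  have hsup : ((p.take a).append (Walk.cons hadj (p.drop b))).support.Sublist p.support := by
    rw [Walk.support_append, Walk.support_cons, List.tail_cons,
      Walk.support_take, Walk.drop_support_eq_support_drop_min,
      min_eq_left (show b ≤ p.length by omega)]
    conv_rhs => rw [← List.take_append_drop (a + 1) p.support]
    exact (List.Sublist.refl _).append (List.drop_sublist_drop_left _ (by omega))
  refine ⟨(p.take a).append (Walk.cons hadj (p.drop b)), ?_, fun w hw => hsup.subset hw, ?_, ?_⟩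
  · rw [Walk.isPath_def]
    exact hsup.nodup hp.support_nodup
  all_goals
    simp only [Walk.length_append, Walk.length_cons, Walk.take_length, Walk.drop_length]
    omega
end

section
/- Let G be a graph on n vertices with independence number at most k, let P be a path in G with endpoints x and y, let c be a positive integer and let U ⊆ V(P). Suppose that c·((|P| − (4c−1)|U|)/(2k) − 1) > k, where |P| denotes the length of P. Then there is an xy-path P' in G such that U ⊆ V(P') ⊆ V(P) and |P| − (4c−3) ≤ |P'| < |P|. -/
open SimpleGraph Finset

inductive PathOn (H : SimpleGraph ℕ) : ℕ → ℕ → Finset ℕ → Prop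
  | single (i : ℕ) : PathOn H i i {i}
  | cons (i j l : ℕ) (S : Finset ℕ) : H.Adj i j → i ∉ S → PathOn H j l S →
      PathOn H i l (insert i S)

theorem PathOn.concat {H : SimpleGraph ℕ} {i j k l : ℕ} {S T : Finset ℕ}
    (h1 : PathOn H i j S) (hjk : H.Adj j k) (h2 : PathOn H k l T) (hd : Disjoint S T) :
    PathOn H i l (S ∪ T) := by
  induction h1 with
  | single i =>
    rw [← Finset.insert_eq]
    exact PathOn.cons _ _ _ _ hjk (by simpa using hd) h2
  | cons a b e S' hab haS _ ih =>
    rw [Finset.insert_union]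
    rw [Finset.disjoint_insert_left] at hd
    exact PathOn.cons _ _ _ _ hab (by simp [haS, hd.1]) (ih hjk hd.2)

theorem PathOn.reverse {H : SimpleGraph ℕ} {i j : ℕ} {S : Finset ℕ}
    (h1 : PathOn H i j S) : PathOn H j i S := by
  induction h1 with
  | single i => exact PathOn.single i
  | cons a b e S' hab haS _ ih =>
    have := ih.concat hab.symm (PathOn.single a) (by simpa using haS)
    rwa [Finset.union_comm, ← Finset.insert_eq] at this

theorem PathOn.interval {H : SimpleGraph ℕ} {m : ℕ} (hH : ∀ i < m, H.Adj i (i+1))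
    (i j : ℕ) (hij : i ≤ j) (hj : j ≤ m) : PathOn H i j (Finset.Icc i j) := by
  induction j, hij using Nat.le_induction with
  | base => simpa using PathOn.single i
  | succ n hn ih =>
    have := (ih (by omega)).concat (hH n (by omega)) (PathOn.single (n+1)) (by simp)
    convert this using 1
    ext t; simp; omega

theorem PathOn.toWalk {H : SimpleGraph ℕ} {V : Type} {G : SimpleGraph V} {v : ℕ → V} {m : ℕ}
    (hv : ∀ i j, i ≤ m → j ≤ m → v i = v j → i = j) (hH : ∀ i j, H.Adj i j → G.Adj (v i) (v j))
    {i j : ℕ} {S : Finset ℕ} (h : PathOn H i j S) (hS : ∀ t ∈ S, t ≤ m) :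
    ∃ q : G.Walk (v i) (v j), q.IsPath ∧ (∀ w, w ∈ q.support ↔ ∃ t ∈ S, v t = w) ∧
      q.length + 1 = S.card := by
  induction h with
  | single i => exact ⟨Walk.nil, by simp, by simp [eq_comm], by simp⟩
  | cons a b e S' hab haS _ ih =>
    obtain ⟨q, hq, hs, hl⟩ := ih (fun t ht => hS t (by simp [ht]))
    refine ⟨Walk.cons (hH _ _ hab) q, ?_, ?_, ?_⟩
    · rw [Walk.cons_isPath_iff]
      refine ⟨hq, fun hm => ?_⟩
      obtain ⟨t, ht, hta⟩ := (hs _).1 hm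
      have := hv t a (hS t (by simp [ht])) (hS a (by simp)) hta
      exact haS (this ▸ ht)
    · intro w
      simp [hs, eq_comm]
    · simp [haS, hl]

/-- the conclusion in index form -/
def Res (H : SimpleGraph ℕ) (m c : ℕ) (I : Finset ℕ) : Prop :=
  ∃ S : Finset ℕ, PathOn H 0 m S ∧ (∀ t ∈ S, t ≤ m) ∧ (∀ t ∈ I, t ∈ S) ∧
    m + 1 ≤ S.card + (4 * c - 3) ∧ S.card < m + 1

theorem res_chord {H : SimpleGraph ℕ} {m c : ℕ} {I : Finset ℕ} (hH : ∀ i < m, H.Adj i (i+1))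
    (hI : ∀ t ∈ I, t ≤ m) {i j : ℕ} (hij : i + 2 ≤ j) (hj : j ≤ m) (hadj : H.Adj i j)
    (hU : ∀ t ∈ I, i < t → t < j → False) (hs : j ≤ i + 1 + (4 * c - 3)) : Res H m c I := by
  have hd : Disjoint (Finset.Icc 0 i) (Finset.Icc j m) := by
    rw [Finset.disjoint_left]; intro t; simp; omega
  refine ⟨Finset.Icc 0 i ∪ Finset.Icc j m, ?_, ?_, ?_, ?_, ?_⟩
  · exact (PathOn.interval hH 0 i (by omega) (by omega)).concat hadj
      (PathOn.interval hH j m hj le_rfl) hd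
  · intro t; simp; omega
  · intro t ht
    have := hI t ht
    have : ¬ (i < t ∧ t < j) := fun h => hU t ht h.1 h.2
    simp; omega
  · rw [Finset.card_union_of_disjoint hd]; simp; omega
  · rw [Finset.card_union_of_disjoint hd]; simp; omega

def Good (m c : ℕ) (I : Finset ℕ) (z : ℕ) : Prop :=
  z + 2 * c ≤ m ∧ ∀ t ∈ I, z < t → t < z + 2 * c → False

def Rl (H : SimpleGraph ℕ) (m w z : ℕ) : Prop := w < z ∧ z + 1 ≤ m ∧ H.Adj w (z+1)

theorem claim {H : SimpleGraph ℕ} {m : ℕ} (hH : ∀ i < m, H.Adj i (i+1)) {e r : ℕ}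
    (h : Relation.ReflTransGen (Rl H m) e r) (hr : r + 1 ≤ m) :
    e ≤ r ∧ ∀ a ≤ e, PathOn H (e+1) a (Finset.Icc a (r+1)) := by
  induction h using Relation.ReflTransGen.head_induction_on with
  | refl => exact ⟨le_rfl, fun a ha => (PathOn.interval hH a (r+1) (by omega) hr).reverse⟩
  | head h1 h2 ih =>
    rename_i e1 e2
    obtain ⟨hlt, hm, hadj⟩ := h1
    refine ⟨by omega, fun a ha => ?_⟩
    have h3 := (ih.2 (e1+1) (by omega)).reverse
    have h4 := h3.concat hadj.symm (PathOn.interval hH a e1 ha (by omega)).reverse (by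
      rw [Finset.disjoint_left]; intro t; simp; omega)
    convert h4 using 1
    ext t; simp; omega

theorem transGen_lt {H : SimpleGraph ℕ} {m a b : ℕ} (h : Relation.TransGen (Rl H m) a b) :
    a < b := by
  induction h with
  | single h => exact h.1
  | tail _ h ih => exact ih.trans h.1

theorem sep {H : SimpleGraph ℕ} {m c : ℕ} {I : Finset ℕ} (hc : 0 < c) (hH : ∀ i < m, H.Adj i (i+1))
    (hI : ∀ t ∈ I, t ≤ m) (hres : ¬ Res H m c I) {w z : ℕ} (h : Rl H m w z)
    (hg : Good m c I w) : w + 2 * c ≤ z := by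
  by_contra hlt
  obtain ⟨h1, h2, h3⟩ := h
  exact hres (res_chord hH hI (by omega) h2 h3
    (fun t ht h4 h5 => hg.2 t ht h4 (by omega)) (by omega))

theorem sep' {H : SimpleGraph ℕ} {m c : ℕ} {I : Finset ℕ} (hc : 0 < c) (hH : ∀ i < m, H.Adj i (i+1))
    (hI : ∀ t ∈ I, t ≤ m) (hres : ¬ Res H m c I) {w z : ℕ} (h : Relation.TransGen (Rl H m) w z)
    (hg : Good m c I w) : w + 2 * c ≤ z := by
  induction h with
  | single h => exact sep hc hH hI hres h hg
  | tail _ h ih => exact ih.trans h.1.le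

theorem closing {H : SimpleGraph ℕ} {m c : ℕ} {I : Finset ℕ} (hc : 0 < c)
    (hH : ∀ i < m, H.Adj i (i+1))
    (hI : ∀ t ∈ I, t ≤ m) {l r : ℕ} (h : Relation.TransGen (Rl H m) l r)
    (hgl : Good m c I l) (hgr : Good m c I r) {i i' : ℕ} (hi : 1 ≤ i) (hic : i ≤ c)
    (hi' : 1 ≤ i') (hic' : i' ≤ c) (hadj : H.Adj (l + 2 * i) (r + 2 * i')) : Res H m c I := by
  by_contra hres
  rw [Relation.TransGen.head'_iff] at h
  obtain ⟨e, h1, h2⟩ := h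
  have hs := sep hc hH hI hres h1 hgl
  have hrm := hgr.1
  obtain ⟨her, hcl⟩ := claim hH h2 (by omega)
  have hd1 : Disjoint (Finset.Icc 0 l) (Finset.Icc (l + 2 * i) (r + 1)) := by
    rw [Finset.disjoint_left]; intro t; simp; omega
  have hd2 : Disjoint (Finset.Icc 0 l ∪ Finset.Icc (l + 2 * i) (r + 1))
      (Finset.Icc (r + 2 * i') m) := by
    rw [Finset.disjoint_left]; intro t; simp; omega
  have hp := ((PathOn.interval hH 0 l (by omega) (by omega)).concat h1.2.2
    (hcl (l + 2 * i) (by omega)) hd1).concat hadj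
    (PathOn.interval hH (r + 2 * i') m (by omega) le_rfl) hd2
  refine hres ⟨_, hp, ?_, ?_, ?_, ?_⟩
  · intro t; simp; omega
  · intro t ht
    have := hI t ht
    have : ¬ (l < t ∧ t < l + 2 * c) := fun h => hgl.2 t ht h.1 h.2
    have : ¬ (r < t ∧ t < r + 2 * c) := fun h => hgr.2 t ht h.1 h.2
    simp; omega
  · rw [Finset.card_union_of_disjoint hd2, Finset.card_union_of_disjoint hd1]; simp; omega
  · rw [Finset.card_union_of_disjoint hd2, Finset.card_union_of_disjoint hd1]; simp; omega

def IndB (H : SimpleGraph ℕ) (m k : ℕ) : Prop :=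
  ∀ s : Finset ℕ, (∀ t ∈ s, t ≤ m) → (∀ x ∈ s, ∀ y ∈ s, x < y → ¬ H.Adj x y) → s.card ≤ k

def Obj (H : SimpleGraph ℕ) (m c : ℕ) (I O : Finset ℕ) : Prop :=
  (∀ z ∈ O, Good m c I z) ∧ ∀ l ∈ O, ∀ r ∈ O, l < r → Relation.TransGen (Rl H m) l r

theorem obj_card {H : SimpleGraph ℕ} {m c k : ℕ} {I O : Finset ℕ} (hc : 0 < c)
    (hH : ∀ i < m, H.Adj i (i+1))
    (hI : ∀ t ∈ I, t ≤ m) (hres : ¬ Res H m c I) (hind : IndB H m k) (hO : Obj H m c I O) :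
    c * O.card ≤ k := by
  have hinj : Set.InjOn (fun q : ℕ × ℕ => q.1 + 2 * q.2) (O ×ˢ Finset.Icc 1 c : Finset (ℕ × ℕ)) := by
    rintro ⟨a, i⟩ ha ⟨b, j⟩ hb hab
    simp at ha hb hab
    rcases lt_trichotomy a b with h | h | h
    · have := sep' hc hH hI hres (hO.2 _ ha.1 _ hb.1 h) (hO.1 _ ha.1)
      omega
    · subst h; simp; omega
    · have := sep' hc hH hI hres (hO.2 _ hb.1 _ ha.1 h) (hO.1 _ hb.1)
      omega
  have hcard := Finset.card_image_of_injOn hinj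
  rw [Finset.card_product, Nat.card_Icc] at hcard
  have := hind ((O ×ˢ Finset.Icc 1 c).image (fun q : ℕ × ℕ => q.1 + 2 * q.2)) ?_ ?_
  · rw [hcard] at this
    simpa [mul_comm] using this
  · intro t ht
    simp at ht
    obtain ⟨a, i, h, rfl⟩ := ht
    have := (hO.1 a h.1).1
    omega
  · intro x hx y hy hxy hadj
    simp at hx hy
    obtain ⟨a, i, ha, rfl⟩ := hx
    obtain ⟨b, j, hb, rfl⟩ := hy
    rcases lt_trichotomy a b with h | h | h
    · exact hres (closing hc hH hI (hO.2 _ ha.1 _ hb.1 h) (hO.1 _ ha.1) (hO.1 _ hb.1)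
        ha.2.1 ha.2.2 hb.2.1 hb.2.2 hadj)
    · subst h
      have hg := hO.1 _ ha.1
      exact hres (res_chord hH hI (by omega) (by have := hg.1; omega) hadj
        (fun t ht h4 h5 => hg.2 t ht (by omega) (by omega)) (by omega))
    · have := sep' hc hH hI hres (hO.2 _ hb.1 _ ha.1 h) (hO.1 _ hb.1)
      omega

open Classical in
theorem exists_d {H : SimpleGraph ℕ} {m c k : ℕ} {I : Finset ℕ} (hc : 0 < c)
    (hH : ∀ i < m, H.Adj i (i+1))
    (hI : ∀ t ∈ I, t ≤ m) (hres : ¬ Res H m c I) (hind : IndB H m k) :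
    ∃ d : ℕ → ℕ, (∀ w z, Rl H m w z → d w + (if Good m c I w then 1 else 0) ≤ d z) ∧
      ∀ z, c * (d z + (if Good m c I z then 1 else 0)) ≤ k := by
  let P : ℕ → ℕ → Prop := fun z n => ∃ O : Finset ℕ, Obj H m c I O ∧
    (∀ o ∈ O, Relation.TransGen (Rl H m) o z) ∧ O.card = n
  have hbd : ∀ z n, P z n → n ≤ k := by
    rintro z n ⟨O, hO, -, rfl⟩
    exact le_trans (Nat.le_mul_of_pos_left _ hc) (obj_card hc hH hI hres hind hO)
  have h0 : ∀ z, P z 0 := fun z => ⟨∅, ⟨by simp, by simp⟩, by simp, by simp⟩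
  have hspec : ∀ z, P z (Nat.findGreatest (P z) k) := fun z =>
    Nat.findGreatest_spec (Nat.zero_le k) (h0 z)
  have hmax : ∀ z n, P z n → n ≤ Nat.findGreatest (P z) k := fun z n h =>
    Nat.le_findGreatest (hbd z n h) h
  have hins : ∀ z (O : Finset ℕ), Obj H m c I O →
      (∀ o ∈ O, Relation.TransGen (Rl H m) o z) → Good m c I z →
      Obj H m c I (insert z O) ∧ (insert z O).card = O.card + 1 := by
    intro z O hO hz hg
    have hlt : ∀ o ∈ O, o < z := fun o ho => transGen_lt (hz o ho)
    refine ⟨⟨?_, ?_⟩, Finset.card_insert_of_notMem (fun h => lt_irrefl _ (hlt z h))⟩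
    · intro a ha
      rcases Finset.mem_insert.1 ha with rfl | ha
      · exact hg
      · exact hO.1 a ha
    · intro a ha0 b hb hab
      rcases Finset.mem_insert.1 ha0 with rfl | ha
      · rcases Finset.mem_insert.1 hb with rfl | hb
        · exact absurd hab (lt_irrefl _)
        · exact absurd hab (hlt b hb).not_gt
      · rcases Finset.mem_insert.1 hb with rfl | hb
        · exact hz a (by assumption)
        · exact hO.2 a (by assumption) b hb hab
  refine ⟨fun z => Nat.findGreatest (P z) k, ?_, ?_⟩
  · intro w z hwz
    obtain ⟨O, hO, hOw, hcard⟩ := hspec w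
    apply hmax
    by_cases hg : Good m c I w
    · obtain ⟨h1, h2⟩ := hins w O hO hOw hg
      refine ⟨insert w O, h1, ?_, by simp [hg, h2, hcard]⟩
      intro o ho
      rcases Finset.mem_insert.1 ho with rfl | ho
      · exact Relation.TransGen.single hwz
      · exact (hOw o ho).tail hwz
    · exact ⟨O, hO, fun o ho => (hOw o ho).tail hwz, by simp [hg, hcard]⟩
  · intro z
    obtain ⟨O, hO, hOw, hcard⟩ := hspec z
    by_cases hg : Good m c I z
    · obtain ⟨h1, h2⟩ := hins z O hO hOw hg
      have := obj_card hc hH hI hres hind h1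
      simpa [hg, ← hcard, h2] using this
    · have := obj_card hc hH hI hres hind hO
      simpa [hg, ← hcard] using this

theorem sum_bound {H : SimpleGraph ℕ} {m c k : ℕ} (hc : 0 < c) (hind : IndB H m k)
    (d ω : ℕ → ℕ) (h1 : ∀ w z, Rl H m w z → d w + ω w ≤ d z)
    (h2 : ∀ z, c * (d z + ω z) ≤ k) : c * ∑ z ∈ Finset.range m, ω z ≤ 2 * k * k := by
  let D : ℕ → ℕ := fun z => if z = 0 then 0 else d (z - 1)
  let g : ℕ → ℕ := fun z => d z + ω z
  have hg : ∀ z, g z ≤ k / c := fun z => by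
    rw [Nat.le_div_iff_mul_le hc, mul_comm]; exact h2 z
  have hpar : ∀ j b, ((Finset.range m).filter (fun z => (D z ≤ j ∧ j < g z) ∧ z % 2 = b)).card ≤ k := by
    intro j b
    apply hind
    · intro t ht
      have := (Finset.mem_filter.1 ht).1
      simp at this; omega
    · intro w hw z hz hwz hadj
      simp only [Finset.mem_filter, Finset.mem_range] at hw hz
      obtain ⟨z', rfl⟩ : ∃ z', z = z' + 1 := ⟨z - 1, by omega⟩
      have h3 := h1 w z' ⟨by omega, by omega, hadj⟩
      have h4 : D (z' + 1) = d z' := by simp [D]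
      have h5 : g w = d w + ω w := rfl
      omega
  have hC : ∀ j, ((Finset.range m).filter (fun z => D z ≤ j ∧ j < g z)).card ≤ 2 * k := by
    intro j
    have : (Finset.range m).filter (fun z => D z ≤ j ∧ j < g z) ⊆
        ((Finset.range m).filter (fun z => (D z ≤ j ∧ j < g z) ∧ z % 2 = 0)) ∪
        ((Finset.range m).filter (fun z => (D z ≤ j ∧ j < g z) ∧ z % 2 = 1)) := by
      intro z hz
      simp only [Finset.mem_filter, Finset.mem_union] at hz ⊢
      rcases Nat.mod_two_eq_zero_or_one z with h | h <;> simp [hz, h]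
    have h3 := (Finset.card_le_card this).trans (Finset.card_union_le _ _)
    have := hpar j 0
    have := hpar j 1
    omega
  have hsum : ∀ n, ∑ z ∈ Finset.range n, ω z + D n ≤ ∑ z ∈ Finset.range n, (g z - D z) := by
    intro n
    induction n with
    | zero => simp [D]
    | succ n ih =>
      rw [Finset.sum_range_succ, Finset.sum_range_succ]
      have h4 : D (n + 1) = d n := by simp [D]
      have h5 : g n = d n + ω n := rfl
      omega
  have hcount : ∀ z, g z - D z = ∑ j ∈ Finset.range (k / c), if D z ≤ j ∧ j < g z then 1 else 0 := by
    intro z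
    rw [← Finset.card_filter, ← Nat.card_Ico]
    congr 1
    ext j
    have := hg z
    simp
    omega
  have h6 : ∑ z ∈ Finset.range m, ω z ≤ (k / c) * (2 * k) := by
    calc ∑ z ∈ Finset.range m, ω z ≤ ∑ z ∈ Finset.range m, (g z - D z) := by
          have := hsum m; omega
      _ = ∑ j ∈ Finset.range (k / c), ∑ z ∈ Finset.range m,
            (if D z ≤ j ∧ j < g z then 1 else 0) := by
          rw [Finset.sum_comm]
          exact Finset.sum_congr rfl (fun z _ => hcount z)
      _ ≤ ∑ j ∈ Finset.range (k / c), 2 * k := by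
          apply Finset.sum_le_sum
          intro j _
          rw [← Finset.card_filter]
          exact hC j
      _ = (k / c) * (2 * k) := by simp
  calc c * ∑ z ∈ Finset.range m, ω z ≤ c * ((k / c) * (2 * k)) := Nat.mul_le_mul_left _ h6
    _ = (c * (k / c)) * (2 * k) := by ring
    _ ≤ k * (2 * k) := Nat.mul_le_mul_right _ (Nat.mul_div_le k c)
    _ = 2 * k * k := by ring

open Classical in
theorem good_count (m c : ℕ) (hc : 0 < c) (I : Finset ℕ) :
    m ≤ ∑ z ∈ Finset.range m, (if Good m c I z then 1 else 0) + (2 * c - 1) * (1 + I.card) := by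
  rw [← Finset.card_filter]
  have hsub : Finset.range m ⊆ (Finset.range m).filter (fun z => Good m c I z) ∪
      (Finset.Ico (m + 1 - 2 * c) m ∪ I.biUnion (fun t => Finset.Ico (t - (2 * c - 1)) t)) := by
    intro z hz
    simp only [Finset.mem_union, Finset.mem_filter, Finset.mem_Ico, Finset.mem_biUnion]
    by_cases hg : Good m c I z
    · exact Or.inl ⟨hz, hg⟩
    · right
      rw [Finset.mem_range] at hz
      by_cases h : z + 2 * c ≤ m
      · right
        unfold Good at hg
        push Not at hg
        obtain ⟨t, ht, h1, h2, -⟩ := hg h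
        exact ⟨t, ht, by omega, h1⟩
      · left; omega
  have h1 := Finset.card_le_card hsub
  have h2 := Finset.card_union_le ((Finset.range m).filter (fun z => Good m c I z))
    (Finset.Ico (m + 1 - 2 * c) m ∪ I.biUnion (fun t => Finset.Ico (t - (2 * c - 1)) t))
  have h3 := Finset.card_union_le (Finset.Ico (m + 1 - 2 * c) m)
    (I.biUnion (fun t => Finset.Ico (t - (2 * c - 1)) t))
  have h4 : (I.biUnion (fun t => Finset.Ico (t - (2 * c - 1)) t)).card ≤ I.card * (2 * c - 1) :=
    Finset.card_biUnion_le_card_mul _ _ _ (fun t _ => by simp; omega)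
  rw [Finset.card_range] at h1
  rw [Nat.card_Ico] at h3
  have : (2 * c - 1) * (1 + I.card) = (2 * c - 1) + I.card * (2 * c - 1) := by ring
  omega

theorem index_main {H : SimpleGraph ℕ} {m c k : ℕ} {I : Finset ℕ} (hc : 0 < c) (hk : 0 < k)
    (hH : ∀ i < m, H.Adj i (i+1))
    (hI : ∀ t ∈ I, t ≤ m) (hind : IndB H m k)
    (hcond : 2 * k * k + 2 * k * c + c * ((4 * c - 1) * I.card) < c * m) : Res H m c I := by
  classical
  by_contra hres
  by_cases hck : c ≤ k
  · obtain ⟨d, h1, h2⟩ := exists_d hc hH hI hres hind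
    have h3 := sum_bound hc hind d (fun z => if Good m c I z then 1 else 0) h1 h2
    have h4 := good_count m c hc I
    have h5 := Nat.mul_le_mul_left c h4
    rw [mul_add] at h5
    have h6 : (2 * c - 1) * (1 + I.card) ≤ 2 * k + (4 * c - 1) * I.card := by
      have : (2 * c - 1) * I.card ≤ (4 * c - 1) * I.card := Nat.mul_le_mul_right _ (by omega)
      rw [mul_add]; omega
    have h7 : c * ((2 * c - 1) * (1 + I.card)) ≤ c * (2 * k) + c * ((4 * c - 1) * I.card) := by
      rw [← mul_add]; exact Nat.mul_le_mul_left c h6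
    have : 2 * k * c = c * (2 * k) := by ring
    omega
  · have h4 := good_count m k hk I
    have hm : 2 * k + (4 * c - 1) * I.card < m := by
      apply Nat.lt_of_mul_lt_mul_left (a := c)
      rw [mul_add]
      have : 2 * k * c = c * (2 * k) := by ring
      omega
    have h6 : (2 * k - 1) * (1 + I.card) ≤ 2 * k + (4 * c - 1) * I.card := by
      have : (2 * k - 1) * I.card ≤ (4 * c - 1) * I.card := Nat.mul_le_mul_right _ (by omega)
      rw [mul_add]; omega
    have h7 : ∑ z ∈ Finset.range m, (if Good m k I z then 1 else 0) ≠ 0 := by omega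
    obtain ⟨z, -, hz⟩ := Finset.exists_ne_zero_of_sum_ne_zero h7
    have hg : Good m k I z := by
      by_contra h; simp [h] at hz
    have := hind ((Finset.range (k+1)).image (fun i => z + 2 * i)) ?_ ?_
    · rw [Finset.card_image_of_injective _ (fun a b h => by simpa using h)] at this
      simp at this
    · intro t ht
      simp at ht
      obtain ⟨i, hi, rfl⟩ := ht
      have := hg.1
      omega
    · intro a ha b hb hab hadj
      simp at ha hb
      obtain ⟨i, hi, rfl⟩ := ha
      obtain ⟨j, hj, rfl⟩ := hb
      have := hg.1
      exact hres (res_chord hH hI (by omega) (by omega) hadj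
        (fun t ht h4 h5 => hg.2 t ht (by omega) (by omega)) (by omega))

/-- Path-shortening preserving a prescribed vertex set U. -/
theorem stmt5 (V : Type) (G : SimpleGraph V) (k : ℕ) (hindep : IndepNumLE G k)
    (x y : V) (p : G.Walk x y) (hp : p.IsPath)
    (c : ℕ) (hc : 0 < c) (U : Finset V) (hU : ∀ u ∈ U, u ∈ p.support)
    (hcond : (c : ℝ) * (((p.length : ℝ) - (4 * (c : ℝ) - 1) * (U.card : ℝ)) / (2 * k) - 1)
      > (k : ℝ)) :
    ∃ q : G.Walk x y, q.IsPath ∧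
      (∀ u ∈ U, u ∈ q.support) ∧ (∀ w ∈ q.support, w ∈ p.support) ∧
      (p.length : ℝ) - (4 * (c : ℝ) - 3) ≤ (q.length : ℝ) ∧ q.length < p.length := by
  classical
  have hk : 0 < k := by
    have := hindep {x} (by
      intro a ha b hb hab
      rw [Finset.mem_singleton] at ha hb
      exact absurd (ha.trans hb.symm) hab)
    rw [Finset.card_singleton] at this
    omega
  have hinj : ∀ i j, i ≤ p.length → j ≤ p.length → p.getVert i = p.getVert j → i = j :=
    fun i j hi hj h => hp.getVert_injOn hi hj h
  let H : SimpleGraph ℕ := G.comap p.getVert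
  have hH : ∀ i < p.length, H.Adj i (i+1) := fun i hi => p.adj_getVert_succ hi
  let I : Finset ℕ := (Finset.range (p.length + 1)).filter (fun i => p.getVert i ∈ U)
  have hI : ∀ t ∈ I, t ≤ p.length := by
    intro t ht
    have := (Finset.mem_filter.1 ht).1
    rw [Finset.mem_range] at this
    omega
  have hIU : I.card ≤ U.card := by
    apply Finset.card_le_card_of_injOn p.getVert
    · intro t ht
      exact (Finset.mem_filter.1 ht).2
    · intro a ha b hb hab
      exact hinj a b (hI a ha) (hI b hb) hab
  have hind : IndB H p.length k := by
    intro s hs hadj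
    rw [← Finset.card_image_of_injOn (s := s) (f := p.getVert)
      (fun a ha b hb hab => hinj a b (hs a ha) (hs b hb) hab)]
    apply hindep
    intro a ha b hb hab h
    obtain ⟨i, hi, rfl⟩ := Finset.mem_image.1 ha
    obtain ⟨j, hj, rfl⟩ := Finset.mem_image.1 hb
    rcases lt_trichotomy i j with hij | hij | hij
    · exact hadj i hi j hj hij h
    · exact hab (by rw [hij])
    · exact hadj j hj i hi hij h.symm
  have hcond' : 2 * k * k + 2 * k * c + c * ((4 * c - 1) * I.card) < c * p.length := by
    have hkR : (0 : ℝ) < k := by exact_mod_cast hk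
    have h1 : 2 * k * k + 2 * k * c + c * ((4 * c - 1) * U.card) < c * p.length := by
      have h4 : ((4 * c - 1 : ℕ) : ℝ) = 4 * (c : ℝ) - 1 := by
        rw [Nat.cast_sub (by omega)]; push_cast; ring
      rw [← Nat.cast_lt (α := ℝ)]
      push_cast
      rw [h4]
      have h5 := mul_lt_mul_of_pos_left hcond (show (0 : ℝ) < 2 * k by positivity)
      have h6 : (2 * (k : ℝ)) * ((c : ℝ) * (((p.length : ℝ) - (4 * (c : ℝ) - 1) * (U.card : ℝ)) / (2 * k) - 1)) = c * ((p.length : ℝ) - (4 * (c : ℝ) - 1) * (U.card : ℝ)) - 2 * k * c := by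
        field_simp
      rw [h6] at h5
      linarith
    have h2 : c * ((4 * c - 1) * I.card) ≤ c * ((4 * c - 1) * U.card) :=
      Nat.mul_le_mul_left _ (Nat.mul_le_mul_left _ hIU)
    omega
  obtain ⟨S, hS, hSm, hSI, hS1, hS2⟩ := index_main hc hk hH hI hind hcond'
  obtain ⟨q, hq, hqs, hql⟩ := hS.toWalk hinj (fun i j h => h) hSm
  refine ⟨q.copy p.getVert_zero p.getVert_length, by simpa using hq, ?_, ?_, ?_, ?_⟩
  · intro u hu
    rw [Walk.support_copy, hqs]
    obtain ⟨n, hn, hnl⟩ := Walk.mem_support_iff_exists_getVert.1 (hU u hu)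
    refine ⟨n, hSI n ?_, hn⟩
    rw [Finset.mem_filter, Finset.mem_range, hn]
    exact ⟨by omega, hu⟩
  · intro w hw
    rw [Walk.support_copy, hqs] at hw
    obtain ⟨t, ht, rfl⟩ := hw
    exact p.getVert_mem_support t
  · rw [Walk.length_copy]
    have h1 : p.length + 3 ≤ q.length + 4 * c := by omega
    have h2 : ((p.length + 3 : ℕ) : ℝ) ≤ ((q.length + 4 * c : ℕ) : ℝ) := by exact_mod_cast h1
    push_cast at h2
    linarith
  · rw [Walk.length_copy]
    omega
end

section
/- Let H be a graph on the vertex set {1, 2, …, n}, let U' ⊆ {1, …, n}, and suppose H has independence number at most k, where k is a positive integer. Then there exists a special vertex sequence in H containing at least (n − |U'|)/(2k) vertices that lie outside U'. -/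
open SimpleGraph Finset

/-- A sequence of vertices `(v₁, …, v_ℓ)` of a graph on the ordered vertex set
`{0, 1, …, n-1}` (represented by `Fin n`) is *special* if it is strictly increasing and
`{vᵢ, v_{i+1} + 1}` is an edge for every i. -/
def IsSpecialSeq {n : ℕ} (H : SimpleGraph (Fin n)) (l : List (Fin n)) : Prop :=
  l ≠ [] ∧ l.Chain' (· < ·) ∧
    l.Chain' (fun (a b : Fin n) => ∃ b' : Fin n, (b' : ℕ) = (b : ℕ) + 1 ∧ H.Adj a b')

open Classical in
noncomputable def spF (r : ℕ → ℕ) (A : ℕ → ℕ → Prop) (v : ℕ) : ℕ :=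
  r v + (Finset.range v).attach.sup (fun u => if A u.1 (v+1) then spF r A u.1 else 0)
termination_by v
decreasing_by exact Finset.mem_range.1 u.2

open Classical in
noncomputable def spG (r : ℕ → ℕ) (A : ℕ → ℕ → Prop) (v : ℕ) : ℕ :=
  (Finset.range (v-1)).sup (fun u => if A u v then spF r A u else 0)

lemma spF_eq (r : ℕ → ℕ) (A : ℕ → ℕ → Prop) (v : ℕ) :
    spF r A v = r v + spG r A (v+1) := by
  classical
  rw [spF, spG]
  congr 1
  exact Finset.sup_attach (Finset.range v) (fun u => if A u (v+1) then spF r A u else 0)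

lemma spG_ge (r : ℕ → ℕ) (A : ℕ → ℕ → Prop) (u v : ℕ) (h : u + 1 < v) (hA : A u v) :
    spF r A u ≤ spG r A v := by
  classical
  have := Finset.le_sup (f := fun u => if A u v then spF r A u else 0)
    (Finset.mem_range.2 (show u < v - 1 by omega))
  simpa [spG, hA] using this

lemma spG_ex (r : ℕ → ℕ) (A : ℕ → ℕ → Prop) (v : ℕ) :
    spG r A v = 0 ∨ ∃ u, u + 1 < v ∧ A u v ∧ spG r A v = spF r A u := by
  classical
  by_cases h0 : spG r A v = 0
  · exact Or.inl h0
  right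
  have hne : (Finset.range (v-1)).Nonempty := by
    by_contra h
    rw [Finset.not_nonempty_iff_eq_empty] at h
    apply h0
    simp [spG, h]
  obtain ⟨u, hu, he⟩ := Finset.exists_mem_eq_sup _ hne (fun u => if A u v then spF r A u else 0)
  change spG r A v = _ at he
  have hu := Finset.mem_range.1 hu
  by_cases hA : A u v
  · exact ⟨u, by omega, hA, by simpa [hA] using he⟩
  · simp [hA] at he
    exact absurd he h0

lemma sp_card {n k : ℕ} (H : SimpleGraph (Fin n)) (hindep : IndepNumLE H k)
    (T : Finset (Fin n)) (hT : ∀ u ∈ T, ∀ v ∈ T, u.1 + 1 < v.1 → ¬ H.Adj u v) :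
    T.card ≤ 2 * k := by
  have key : ∀ p : Fin n → Prop, ∀ [DecidablePred p],
      (∀ u v, p u → p v → u.1 % 2 = v.1 % 2) → (T.filter p).card ≤ k := by
    intro p _ hp
    apply hindep
    intro x hx y hy hxy hadj
    rw [Finset.mem_filter] at hx hy
    have h1 := hp x y hx.2 hy.2
    have h2 : x.1 ≠ y.1 := fun h => hxy (Fin.ext h)
    rcases lt_or_gt_of_ne h2 with h | h
    · exact hT x hx.1 y hy.1 (by omega) hadj
    · exact hT y hy.1 x hx.1 (by omega) hadj.symm
  have h1 := key (fun u => u.1 % 2 = 0) (by intros; omega)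
  have h2 := key (fun u => ¬ u.1 % 2 = 0) (by intros; omega)
  have h3 := Finset.card_filter_add_card_filter_not (s := T) (fun u : Fin n => u.1 % 2 = 0)
  omega

lemma sp_list {n : ℕ} (H : SimpleGraph (Fin n)) (U' : Finset (Fin n)) (r : ℕ → ℕ)
    (hr : ∀ v : Fin n, r v = if v ∉ U' then 1 else 0) (A : ℕ → ℕ → Prop)
    (hA : ∀ u v, A u v → ∃ (hu : u < n) (hv : v < n), H.Adj ⟨u, hu⟩ ⟨v, hv⟩) :
    ∀ (m : ℕ) (v : Fin n), v.1 = m → ∃ l : List (Fin n),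
      (v :: l).IsChain (fun b a => a < b) ∧
      (v :: l).IsChain (fun (b a : Fin n) => ∃ b' : Fin n, (b' : ℕ) = (b : ℕ) + 1 ∧ H.Adj a b') ∧
      ((v :: l).filter (fun v => v ∉ U')).length = spF r A m := by
  intro m
  induction m using Nat.strong_induction_on with
  | _ m ih =>
  intro v hv
  rw [spF_eq, ← hv, hr]
  rcases spG_ex r A (v.1+1) with h | ⟨u, hu, hAu, he⟩
  · refine ⟨[], by simp, by simp, ?_⟩
    rw [h]
    by_cases hU : v ∈ U' <;> simp [hU]
  · obtain ⟨hun, hvn, hadj⟩ := hA _ _ hAu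
    obtain ⟨l, h1, h2, h3⟩ := ih u (by omega) ⟨u, hun⟩ rfl
    refine ⟨⟨u, hun⟩ :: l, ?_, ?_, ?_⟩
    · exact List.isChain_cons_cons.2 ⟨by rw [Fin.lt_def]; simp; omega, h1⟩
    · exact List.isChain_cons_cons.2 ⟨⟨⟨_, hvn⟩, rfl, hadj⟩, h2⟩
    · rw [he, ← h3, List.filter_cons]
      by_cases hU : v ∈ U' <;> simp [hU, add_comm]

/-- In a graph on `n ≥ 1` linearly ordered vertices with independence number at most k,
there is a special vertex sequence with at least (n - |U'|)/(2k) vertices outside U'. -/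
theorem stmt6 (n k : ℕ) (hn : 0 < n) (hk : 0 < k) (H : SimpleGraph (Fin n))
    (hindep : IndepNumLE H k) (U' : Finset (Fin n)) :
    ∃ l : List (Fin n), IsSpecialSeq H l ∧
      ((n : ℝ) - (U'.card : ℝ)) / (2 * k) ≤ ((l.filter (fun v => v ∉ U')).length : ℝ) := by
  classical
  let r : ℕ → ℕ := fun m => if h : m < n then (if (⟨m, h⟩ : Fin n) ∉ U' then 1 else 0) else 0
  have hr : ∀ v : Fin n, r v = if v ∉ U' then 1 else 0 := by
    intro v; simp [r]
  let A : ℕ → ℕ → Prop := fun u v => ∃ (hu : u < n) (hv : v < n), H.Adj ⟨u, hu⟩ ⟨v, hv⟩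
  have hl := sp_list H U' r hr A (fun _ _ h => h)
  haveI : Nonempty (Fin n) := ⟨⟨0, hn⟩⟩
  obtain ⟨w, hw⟩ := Finite.exists_max (fun v : Fin n => spF r A v)
  obtain ⟨l, h1, h2, h3⟩ := hl w.1 w rfl
  refine ⟨(w :: l).reverse, ⟨by simp, ?_, ?_⟩, ?_⟩
  · exact List.isChain_reverse.2 h1
  · exact List.isChain_reverse.2 h2
  rw [List.filter_reverse, List.length_reverse, h3]
  set L := spF r A w.1 with hL
  have hG0 : spG r A 0 = 0 := by simp [spG]
  have hGn : spG r A n = 0 := by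
    rcases spG_ex r A n with h | ⟨u, _, ⟨_, h, _⟩, _⟩
    · exact h
    · omega
  have hsum : ∑ v : Fin n, spF r A v = ∑ v : Fin n, r v + ∑ v : Fin n, spG r A v := by
    rw [Fin.sum_univ_eq_sum_range (fun v => spF r A v), Fin.sum_univ_eq_sum_range (fun v => r v),
      Fin.sum_univ_eq_sum_range (fun v => spG r A v)]
    simp only [spF_eq, Finset.sum_add_distrib]
    have a := Finset.sum_range_succ (fun v => spG r A v) n
    have b := Finset.sum_range_succ' (fun v => spG r A v) n
    simp only [hG0, hGn] at a b
    omega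
  have hrsum : ∑ v : Fin n, r v + U'.card = n := by
    simp only [hr]
    rw [← Finset.card_filter, ← Finset.compl_filter, Finset.filter_univ_mem, Finset.card_compl,
      Fintype.card_fin]
    have := Finset.card_le_univ U'
    rw [Fintype.card_fin] at this
    omega
  have hF : ∀ v : Fin n, spF r A v ≤ spG r A v +
      ((Finset.Icc 1 L).filter (fun t => spG r A v < t ∧ t ≤ spF r A v)).card := by
    intro v
    have hs : Finset.Ioc (spG r A v) (spF r A v) ⊆
        (Finset.Icc 1 L).filter (fun t => spG r A v < t ∧ t ≤ spF r A v) := by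
      intro t ht
      rw [Finset.mem_Ioc] at ht
      have := hw v
      rw [Finset.mem_filter, Finset.mem_Icc]
      refine ⟨⟨by omega, ht.2.trans this⟩, ht⟩
    have := Finset.card_le_card hs
    rw [Nat.card_Ioc] at this
    omega
  have hF2 := Finset.sum_le_sum (s := Finset.univ) (fun v _ => hF v)
  rw [hsum, Finset.sum_add_distrib] at hF2
  have hdc : ∑ v : Fin n, ((Finset.Icc 1 L).filter (fun t => spG r A v < t ∧ t ≤ spF r A v)).card
      = ∑ t ∈ Finset.Icc 1 L,
        (Finset.univ.filter (fun v : Fin n => spG r A v < t ∧ t ≤ spF r A v)).card := by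
    simp only [Finset.card_filter]
    exact Finset.sum_comm
  have hlev : ∑ t ∈ Finset.Icc 1 L,
        (Finset.univ.filter (fun v : Fin n => spG r A v < t ∧ t ≤ spF r A v)).card
      ≤ L * (2 * k) := by
    have := Finset.sum_le_card_nsmul (Finset.Icc 1 L) (fun t =>
        (Finset.univ.filter (fun v : Fin n => spG r A v < t ∧ t ≤ spF r A v)).card) (2 * k) ?_
    · simpa using this
    intro t _
    apply sp_card H hindep
    intro u hu v hv huv hadj
    rw [Finset.mem_filter] at hu hv
    have := spG_ge r A u v huv ⟨u.2, v.2, hadj⟩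
    omega
  have hfin : n ≤ L * (2 * k) + U'.card := by omega
  have hk' : (0 : ℝ) < 2 * k := by positivity
  rw [div_le_iff₀ hk']
  have : (n : ℝ) ≤ L * (2 * k) + U'.card := by exact_mod_cast hfin
  linarith
end

section
/- There exists ε₀ > 0 such that for every real ε with 0 < ε < ε₀ there exists k₀ so that for every integer k ≥ k₀ the following holds. If G is a Hamiltonian graph on n ≥ (2+ε)k² vertices with independence number at most k, then V(G) can be partitioned into two parts: the vertex set of a cycle C of G, and a set S with |S| = ⌊εn/20⌋, such that G contains a matching M all of whose edges have one endpoint in V(C) and the other in S, and M covers every vertex of S. -/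
open SimpleGraph Finset

/-- a path from a to b whose vertex set is described by P -/
def PathOn_s7 {α : Type} (A : α → α → Prop) (a b : α) (P : α → Prop) : Prop :=
  ∃ L : List α, L.IsChain A ∧ L.Nodup ∧ L.head? = some a ∧ L.getLast? = some b ∧ ∀ p, p ∈ L ↔ P p

theorem PathOn_s7.rev {α : Type} {A : α → α → Prop} (hs : ∀ x y, A x y → A y x) {a b : α}
    {P : α → Prop} (h : PathOn_s7 A a b P) : PathOn_s7 A b a P := by
  obtain ⟨L, h1, h2, h3, h4, h5⟩ := h
  refine ⟨L.reverse, ?_, by simpa using h2, by simpa using h4, by simpa using h3, by simpa using h5⟩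
  rw [List.isChain_reverse]
  exact h1.imp (fun x y h => hs x y h)

theorem PathOn_s7.app {α : Type} {A : α → α → Prop} {a b c d : α}
    {P Q R : α → Prop} (h : PathOn_s7 A a b P) (h' : PathOn_s7 A c d Q) (hbc : A b c)
    (hd : ∀ p, P p → Q p → False) (hR : ∀ p, R p ↔ P p ∨ Q p) : PathOn_s7 A a d R := by
  obtain ⟨L, h1, h2, h3, h4, h5⟩ := h
  obtain ⟨L', h1', h2', h3', h4', h5'⟩ := h'
  refine ⟨L ++ L', ?_, ?_, ?_, ?_, ?_⟩
  · rw [List.isChain_append]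
    refine ⟨h1, h1', ?_⟩
    simp [h4, h3', hbc]
  · rw [List.nodup_append']
    refine ⟨h2, h2', ?_⟩
    intro p hp hp'
    exact hd p ((h5 p).1 hp) ((h5' p).1 hp')
  · simp [List.head?_append, h3]
  · simp [List.getLast?_append, h4']
  · intro p
    simp [h5, h5', hR]

theorem PathOn_s7.ico {A : ℕ → ℕ → Prop} {a : ℕ} : ∀ {b : ℕ}, a ≤ b →
    (∀ i, a ≤ i → i < b → A i (i+1)) → PathOn_s7 A a b (fun p => a ≤ p ∧ p ≤ b) := by
  intro b hab
  induction b, hab using Nat.le_induction with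
  | base =>
    intro _
    refine ⟨[a], by simp, by simp, by simp, by simp, ?_⟩
    intro p
    simp
    omega
  | succ b hab ih =>
    intro h
    refine PathOn_s7.app (ih (fun i h1 h2 => h i h1 (by omega)))
      (Q := fun p => p = b+1) (c := b+1) ⟨[b+1], by simp, by simp, by simp, by simp, by simp⟩
      (h b hab (by omega)) ?_ ?_
    · intro p h1 h2; omega
    · intro p; omega

def StepR (A : ℕ → ℕ → Prop) (N : ℕ) (W : Finset ℕ) (t t' : ℕ) : Prop :=
  2 ≤ t ∧ t < t' ∧ t' < N ∧ A (t-1) t' ∧ (t + 2 ≤ t' ∨ t' ∉ W)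

def ReachR (A : ℕ → ℕ → Prop) (N : ℕ) (W : Finset ℕ) : ℕ → ℕ → Prop :=
  Relation.ReflTransGen (StepR A N W)

theorem ReachR.le {A : ℕ → ℕ → Prop} {N : ℕ} {W : Finset ℕ} {t t' : ℕ}
    (h : ReachR A N W t t') : t ≤ t' := by
  induction h with
  | refl => exact le_refl _
  | tail _ h ih => exact ih.trans h.2.1.le

def PosCyc (A : ℕ → ℕ → Prop) (N d : ℕ) : Prop :=
  ∃ a b, PathOn_s7 A a b (fun p => p < N ∧ p ≠ d) ∧ A b a

theorem reach_path {A : ℕ → ℕ → Prop} {N : ℕ} {W : Finset ℕ}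
    (hs : ∀ x y, A x y → A y x) (hA : ∀ i, i + 1 < N → A i (i+1)) {t t' : ℕ} (ht : 2 ≤ t)
    (htN : t < N)
    (h : ReachR A N W t t') :
    t' < N ∧ ∃ u, PathOn_s7 A u (t'-1) (fun p => t-1 ≤ p ∧ p ≤ t'-1) ∧ A u t' := by
  induction h with
  | refl =>
    refine ⟨htN, t-1, PathOn_s7.ico le_rfl (fun i h1 h2 => by omega), ?_⟩
    have := hA (t-1) (by omega)
    rwa [Nat.sub_add_cancel (by omega)] at this
  | @tail s t'' hr h ih =>
    obtain ⟨hsN, u, hp, hu⟩ := ih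
    obtain ⟨h1, h2, h3, h4, h5⟩ := h
    have hle := ReachR.le hr
    refine ⟨h3, s-1, ?_, h4⟩
    refine PathOn_s7.app (hp.rev hs) (PathOn_s7.ico (a := s) (b := t''-1) (by omega)
      (fun i h1 h2 => hA i (by omega))) hu ?_ ?_
    · intro p h1 h2; omega
    · intro p; omega

theorem closing_s7 {A : ℕ → ℕ → Prop} {N : ℕ} {W : Finset ℕ}
    (hs : ∀ x y, A x y → A y x) (hA : ∀ i, i + 1 < N → A i (i+1)) (hN : A (N-1) 0) {a s b : ℕ}
    (ha : 2 ≤ a) (haN : a < N)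
    (h : ReachR A N W a s) (h' : StepR A N W s b) (hsb : s + 2 ≤ b) (hab : A (a-2) (b-2)) :
    PosCyc A N (b-1) := by
  obtain ⟨hsN, u, hp, hu⟩ := reach_path hs hA ha haN h
  obtain ⟨h1, h2, h3, h4, h5⟩ := h'
  have hle := ReachR.le h
  refine ⟨a-2, b-2, ?_, hs _ _ hab⟩
  have p1 := (PathOn_s7.ico (A := A) (a := 0) (b := a-2) (by omega)
      (fun i h1 h2 => hA i (by omega))).rev hs
  have p2 := (PathOn_s7.ico (A := A) (a := b) (b := N-1) (by omega)
      (fun i h1 h2 => hA i (by omega))).rev hs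
  have p3 := hp.rev hs
  have p4 := (PathOn_s7.ico (A := A) (a := s) (b := b-2) (by omega)
      (fun i h1 h2 => hA i (by omega)))
  have p12 := p1.app p2 (R := fun p => p ≤ a - 2 ∨ (b ≤ p ∧ p ≤ N-1)) (hs _ _ hN)
    (fun p h1 h2 => by omega) (fun p => by omega)
  have p34 := p3.app p4 (R := fun p => a - 1 ≤ p ∧ p ≤ b-2) hu
    (fun p h1 h2 => by omega) (fun p => by omega)
  exact p12.app p34 (hs _ _ h4) (fun p h1 h2 => by omega) (fun p => by omega)

theorem short_chord {A : ℕ → ℕ → Prop} {N : ℕ}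
    (hs : ∀ x y, A x y → A y x) (hA : ∀ i, i + 1 < N → A i (i+1)) (hN : A (N-1) 0) {x : ℕ}
    (hx : x + 2 < N) (hab : A x (x+2)) :
    PosCyc A N (x+1) := by
  refine ⟨x, x+2, ?_, hs _ _ hab⟩
  have p1 := (PathOn_s7.ico (A := A) (a := 0) (b := x) (by omega)
      (fun i h1 h2 => hA i (by omega))).rev hs
  have p2 := (PathOn_s7.ico (A := A) (a := x+2) (b := N-1) (by omega)
      (fun i h1 h2 => hA i (by omega))).rev hs
  exact p1.app p2 (hs _ _ hN) (fun p h1 h2 => by omega) (fun p => by omega)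

def GoodF (A : ℕ → ℕ → Prop) (N : ℕ) (W : Finset ℕ) (t : ℕ) (F : Finset ℕ) : Prop :=
  (∀ a ∈ F, ReachR A N W a t) ∧ ∀ a ∈ F, ∀ b ∈ F, a < b → ReachR A N W a b

open Classical in
noncomputable def lam (A : ℕ → ℕ → Prop) (N : ℕ) (W : Finset ℕ) (t : ℕ) : ℕ :=
  (W.powerset.filter (GoodF A N W t)).sup Finset.card

theorem le_lam {A : ℕ → ℕ → Prop} {N : ℕ} {W : Finset ℕ} {t : ℕ} (F : Finset ℕ) (hF : F ⊆ W)
    (h1 : ∀ a ∈ F, ReachR A N W a t) (h2 : ∀ a ∈ F, ∀ b ∈ F, a < b → ReachR A N W a b) :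
    F.card ≤ lam A N W t := by
  classical
  unfold lam
  refine Finset.le_sup (f := Finset.card) (b := F) ?_
  rw [Finset.mem_filter, Finset.mem_powerset]
  exact ⟨hF, h1, h2⟩

theorem lam_ex (A : ℕ → ℕ → Prop) (N : ℕ) (W : Finset ℕ) (t : ℕ) : ∃ F : Finset ℕ, F ⊆ W ∧
    (∀ a ∈ F, ReachR A N W a t) ∧ (∀ a ∈ F, ∀ b ∈ F, a < b → ReachR A N W a b) ∧
    F.card = lam A N W t := by
  classical
  unfold lam
  obtain ⟨F, hF, hc⟩ := Finset.exists_mem_eq_sup (W.powerset.filter (GoodF A N W t))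
    ⟨∅, by simp [GoodF]⟩ Finset.card
  rw [Finset.mem_filter, Finset.mem_powerset] at hF
  exact ⟨F, hF.1, hF.2.1, hF.2.2, hc.symm⟩

theorem lam_one {A : ℕ → ℕ → Prop} {N : ℕ} {W : Finset ℕ} {t : ℕ} (ht : t ∈ W) :
    1 ≤ lam A N W t := by
  have := le_lam (A := A) (N := N) (W := W) (t := t) {t} (by simpa using ht)
    (by simp [ReachR, Relation.ReflTransGen.refl]) (by simp)
  simpa using this

theorem lam_step {A : ℕ → ℕ → Prop} {N : ℕ} {W : Finset ℕ} {t t' : ℕ} (h : StepR A N W t t') :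
    lam A N W t + (if t' ∈ W then 1 else 0) ≤ lam A N W t' := by
  obtain ⟨F, hF, h1, h2, hc⟩ := lam_ex A N W t
  have h1' : ∀ a ∈ F, ReachR A N W a t' := fun a ha => (h1 a ha).tail h
  split_ifs with hw
  · have hlt : ∀ a ∈ F, a < t' := fun a ha => lt_of_le_of_lt (h1 a ha).le h.2.1
    have hn : t' ∉ F := fun h => lt_irrefl _ (hlt _ h)
    rw [← hc, ← Finset.card_insert_of_notMem hn]
    apply le_lam
    · intro a ha
      rcases Finset.mem_insert.1 ha with rfl | ha
      · exact hw
      · exact hF ha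
    · intro a ha
      rcases Finset.mem_insert.1 ha with rfl | ha
      · exact Relation.ReflTransGen.refl
      · exact h1' a ha
    · intro a ha b hb hab
      rcases Finset.mem_insert.1 ha with hae | haF
      · rcases Finset.mem_insert.1 hb with hbe | hbF
        · omega
        · have := hlt b hbF; omega
      · rcases Finset.mem_insert.1 hb with hbe | hbF
        · rw [hbe]; exact h1' a haF
        · exact h2 a haF b hbF hab
  · rw [add_zero, ← hc]
    exact le_lam F hF h1' h2

theorem indep_of_lt {A : ℕ → ℕ → Prop} (hs : ∀ x y, A x y → A y x) {F : Finset ℕ}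
    (h : ∀ x ∈ F, ∀ y ∈ F, x < y → ¬ A x y) : ∀ x ∈ F, ∀ y ∈ F, x ≠ y → ¬ A x y := by
  intro x hx y hy hxy hA
  rcases lt_or_gt_of_ne hxy with h1 | h1
  · exact h x hx y hy h1 hA
  · exact h y hy x hx h1 (hs _ _ hA)

theorem position {A : ℕ → ℕ → Prop} {N k : ℕ} (hN4 : 4 ≤ N)
    (hs : ∀ x y, A x y → A y x) (hA : ∀ i, i + 1 < N → A i (i+1)) (hN : A (N-1) 0)
    (hk : ∀ F : Finset ℕ, (∀ x ∈ F, x < N) → (∀ x ∈ F, ∀ y ∈ F, x ≠ y → ¬ A x y) → F.card ≤ k)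
    (W : Finset ℕ) (hW : ∀ t ∈ W, 2 ≤ t ∧ t < N - 1) (hcard : 2 * k^2 + k < W.card) :
    ∃ t ∈ W, PosCyc A N (t-1) := by
  classical
  by_contra hcon
  push Not at hcon
  have hlk : ∀ t, lam A N W t ≤ k := by
    intro t
    obtain ⟨F, hF, h1, h2, hc⟩ := lam_ex A N W t
    rw [← hc]
    have hinj : Set.InjOn (fun a => a - 2) (F : Set ℕ) := by
      intro a ha b hb hab
      have := hW a (hF ha)
      have := hW b (hF hb)
      simp only at hab
      omega
    rw [← Finset.card_image_of_injOn hinj]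
    apply hk
    · intro x hx
      obtain ⟨a, ha, rfl⟩ := Finset.mem_image.1 hx
      have := hW a (hF ha)
      omega
    · apply indep_of_lt hs
      intro x hx y hy hxy hAxy
      obtain ⟨a, ha, rfl⟩ := Finset.mem_image.1 hx
      obtain ⟨b, hb, rfl⟩ := Finset.mem_image.1 hy
      have hab : a < b := by omega
      have haW := hW a (hF ha)
      rcases Relation.ReflTransGen.cases_tail (h2 a ha b hb hab) with h | ⟨s, hr, hst⟩
      · omega
      · apply hcon b (hF hb)
        refine closing_s7 hs hA hN haW.1 (by omega) hr hst ?_ hAxy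
        exact hst.2.2.2.2.resolve_right (fun h => h (hF hb))
  set l := lam A N W with hl
  set w : ℕ → ℕ := fun v => if v ∈ W then 1 else 0 with hw
  let r : ℕ → ℕ → Prop := fun c v => l v + 1 ≤ c + w v ∧ c ≤ l (v+1)
  have hQ : ∀ c ∈ Finset.Icc 1 k,
      ((Finset.Ico 2 (N-1)).bipartiteAbove r c).card ≤ 2 * k := by
    intro c hc
    set Q := (Finset.Ico 2 (N-1)).bipartiteAbove r c with hQdef
    have hmem : ∀ x, x ∈ Q ↔ (2 ≤ x ∧ x < N-1) ∧ r c x := by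
      intro x; simp [hQdef, Finset.mem_bipartiteAbove]
    have hadj : ∀ x ∈ Q, ∀ y ∈ Q, x + 2 ≤ y → ¬ A x y := by
      intro x hx y hy hxy hAxy
      obtain ⟨⟨hx1, hx2⟩, hx3, hx4⟩ := (hmem x).1 hx
      obtain ⟨⟨hy1, hy2⟩, hy3, hy4⟩ := (hmem y).1 hy
      by_cases hcase : y = x + 2 ∧ y ∈ W
      · obtain ⟨rfl, hyW⟩ := hcase
        exact hcon _ hyW (short_chord hs hA hN (by omega) hAxy)
      · have hst : StepR A N W (x+1) y := by
          refine ⟨by omega, by omega, by omega, by simpa using hAxy, ?_⟩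
          by_cases hyW : y ∈ W
          · left
            have : y ≠ x + 2 := fun h => hcase ⟨h, hyW⟩
            omega
          · right; exact hyW
        have := lam_step hst
        rw [← hl] at this
        change l (x+1) + w y ≤ l y at this
        omega
    have he : ∀ i, (Q.filter (fun x => x % 2 = i)).card ≤ k := by
      intro i
      apply hk
      · intro x hx
        have := (hmem x).1 (Finset.mem_filter.1 hx).1
        omega
      · apply indep_of_lt hs
        intro x hx y hy hxy
        rw [Finset.mem_filter] at hx hy
        exact hadj x hx.1 y hy.1 (by omega)
    have hcov : Q ⊆ Q.filter (fun x => x % 2 = 0) ∪ Q.filter (fun x => x % 2 = 1) := by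
      intro x hx
      rw [Finset.mem_union, Finset.mem_filter, Finset.mem_filter]
      rcases Nat.mod_two_eq_zero_or_one x with h | h
      · left; exact ⟨hx, h⟩
      · right; exact ⟨hx, h⟩
    have h1 := Finset.card_le_card hcov
    have h2 := Finset.card_union_le (Q.filter (fun x => x % 2 = 0)) (Q.filter (fun x => x % 2 = 1))
    have h3 := he 0
    have h4 := he 1
    omega
  have hcount : ∀ v ∈ Finset.Ico 2 (N-1), (l (v+1) : ℤ) - l v + w v ≤
      (((Finset.Icc 1 k).bipartiteBelow r v).card : ℤ) := by
    intro v hv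
    have hsub : Finset.Icc (l v + 1 - w v) (l (v+1)) ⊆ (Finset.Icc 1 k).bipartiteBelow r v := by
      intro c hc
      rw [Finset.mem_Icc] at hc
      rw [Finset.mem_bipartiteBelow, Finset.mem_Icc]
      have h1 := hlk (v+1)
      have h2 : 1 ≤ l v + 1 - w v := by
        simp only [hw]
        split_ifs with h
        · have := lam_one (A := A) (N := N) h
          rw [← hl] at this
          omega
        · omega
      refine ⟨⟨by omega, by omega⟩, by omega, hc.2⟩
    have h1 := Finset.card_le_card hsub
    rw [Nat.card_Icc] at h1
    have h2 : w v ≤ 1 := by simp only [hw]; split_ifs <;> omega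
    omega
  have hdc := Finset.sum_card_bipartiteAbove_eq_sum_card_bipartiteBelow
    (s := Finset.Icc 1 k) (t := Finset.Ico 2 (N-1)) r
  have hup := Finset.sum_le_card_nsmul _ _ _ hQ
  have hlow := Finset.sum_le_sum hcount
  rw [Finset.sum_add_distrib, Finset.sum_Ico_sub (fun v => (l v : ℤ)) (by omega)] at hlow
  have hwsum : ∑ v ∈ Finset.Ico 2 (N-1), (w v : ℤ) = W.card := by
    simp only [hw]
    push_cast
    rw [Finset.sum_ite_mem, Finset.inter_eq_right.2 (fun t ht => by
      have := hW t ht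
      rw [Finset.mem_Ico]; exact this)]
    simp
  rw [hwsum] at hlow
  have hdc' : ∑ v ∈ Finset.Ico 2 (N-1), (((Finset.Icc 1 k).bipartiteBelow r v).card : ℤ)
      ≤ 2 * k^2 := by
    rw [← Nat.cast_sum, ← hdc]
    simp only [Nat.card_Icc, smul_eq_mul, Nat.add_sub_cancel] at hup
    have : k * (2*k) = 2 * k^2 := by ring
    rw [this] at hup
    exact_mod_cast hup
  have h2 := hlk 2
  have h3 : ((2 * k^2 + k : ℕ) : ℤ) < W.card := by exact_mod_cast hcard
  push_cast at h3
  zify at h2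
  have h4 : (0:ℤ) ≤ l (N-1) := by positivity
  linarith

theorem PathOn_s7.map {α β : Type} {R : β → β → Prop} (f : α → β) {a b : α} {P : α → Prop}
    {Q : β → Prop}
    (h : PathOn_s7 (fun x y => R (f x) (f y)) a b P) (hf : ∀ x y, P x → P y → f x = f y → x = y)
    (hQ : ∀ z, Q z ↔ ∃ x, P x ∧ f x = z) :
    PathOn_s7 R (f a) (f b) Q := by
  obtain ⟨L, h1, h2, h3, h4, h5⟩ := h
  refine ⟨L.map f, ?_, ?_, by simp [h3], by simp [h4], ?_⟩
  · rw [List.isChain_map]; exact h1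
  · apply List.Nodup.map_on _ h2
    intro x hx y hy
    exact hf x y ((h5 x).1 hx) ((h5 y).1 hy)
  · intro z
    simp [hQ, h5]

def CycOn {V : Type} (G : SimpleGraph V) (P : V → Prop) : Prop :=
  ∃ a b, PathOn_s7 G.Adj a b P ∧ G.Adj b a

theorem cycOn_of_walk {V : Type} {G : SimpleGraph V} {v : V} (c : G.Walk v v) (hc : c.IsCycle) :
    CycOn G (fun x => x ∈ c.support) := by
  cases c with
  | nil => simp at hc
  | @cons _ u _ h p =>
    refine ⟨u, v, ⟨p.support, p.isChain_adj_support, ?_, ?_, ?_, ?_⟩, h⟩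
    · exact ((Walk.cons_isCycle_iff _ _).1 hc).1.support_nodup
    · rw [List.head?_eq_some_head p.support_ne_nil]; simp
    · rw [List.getLast?_eq_some_getLast p.support_ne_nil]; simp
    · intro x
      simp only [Walk.support_cons, List.mem_cons]
      constructor
      · exact Or.inr
      · rintro (rfl | hx)
        · exact p.end_mem_support
        · exact hx

theorem walk_of_cycOn {V : Type} {G : SimpleGraph V} {P : V → Prop} (h : CycOn G P)
    (F : Finset V) (hF : ∀ x ∈ F, P x) (hF3 : 3 ≤ F.card) :
    ∃ (v : V) (c : G.Walk v v), c.IsCycle ∧ ∀ x, x ∈ c.support ↔ P x := by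
  classical
  obtain ⟨a, b, ⟨L, h1, h2, h3, h4, h5⟩, hab⟩ := h
  have hlen : 3 ≤ L.length := by
    have : F ⊆ L.toFinset := fun x hx => by simpa using (h5 x).2 (hF x hx)
    have := Finset.card_le_card this
    have := List.toFinset_card_le L
    omega
  have hne : L ≠ [] := by rintro rfl; simp at hlen
  have ha : L.head hne = a := by
    rw [List.head?_eq_some_head hne] at h3; simpa using h3
  have hb : L.getLast hne = b := by
    rw [List.getLast?_eq_some_getLast hne] at h4; simpa using h4
  subst ha hb
  let p := Walk.ofSupport L hne h1
  have hps : p.support = L := Walk.support_ofSupport hne h1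
  have hpl : p.length = L.length - 1 := Walk.length_ofSupport hne h1
  refine ⟨_, Walk.cons hab p, ?_, ?_⟩
  · rw [Walk.isCycle_iff_isPath_tail_and_le_length]
    constructor
    · have hpp : p.IsPath := by
        rw [Walk.isPath_def, hps]
        exact h2
      simpa only [Walk.getVert_cons_succ, Walk.tail_cons, Walk.isPath_copy] using hpp
    · rw [Walk.length_cons]; omega
  · intro x
    rw [Walk.support_cons, hps, ← h5, List.mem_cons]
    constructor
    · rintro (rfl | hx)
      · exact List.getLast_mem hne
      · exact hx
    · exact Or.inr

theorem one_step {V : Type} [Fintype V] [DecidableEq V] {G : SimpleGraph V} {k : ℕ}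
    (hk : IndepNumLE G k)
    (S : Finset V) (m : V → V) (hC : CycOn G (fun x => x ∉ S))
    (hm : ∀ x ∈ S, m x ∉ S ∧ G.Adj x (m x))
    (hinj : ∀ x ∈ S, ∀ y ∈ S, x ≠ y → m x ≠ m y)
    (hcard : 2 * k^2 + k + 3 * S.card + 4 ≤ Fintype.card V) :
    ∃ (S' : Finset V) (m' : V → V), S'.card = S.card + 1 ∧ CycOn G (fun x => x ∉ S') ∧
      (∀ x ∈ S', m' x ∉ S' ∧ G.Adj x (m' x)) ∧
      (∀ x ∈ S', ∀ y ∈ S', x ≠ y → m' x ≠ m' y) := by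
  obtain ⟨a, b, ⟨L, h1, h2, h3, h4, h5⟩, hab⟩ := hC
  have hLS : L.toFinset = Sᶜ := by ext x; simp [h5]
  have hN : L.length = Fintype.card V - S.card := by
    rw [← List.toFinset_card_of_nodup h2, hLS, Finset.card_compl]
  have hne : L ≠ [] := by rintro rfl; simp at h3
  set N := L.length with hNdef
  let p : ℕ → V := fun i => L.getD i a
  have hp : ∀ i (h : i < N), p i = L[i] := fun i h => by
    simp only [p]; rw [List.getD_eq_getElem]
  have hpS : ∀ i, i < N → p i ∉ S := fun i h => by
    rw [hp i h]; exact (h5 _).1 (List.getElem_mem _)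
  have hpinj : ∀ i j, i < N → j < N → p i = p j → i = j := by
    intro i j hi hj h
    rw [hp i hi, hp j hj] at h
    exact (List.Nodup.getElem_inj_iff h2).1 h
  have hpsurj : ∀ x, x ∉ S → ∃ i, i < N ∧ p i = x := by
    intro x hx
    obtain ⟨i, hi, h⟩ := List.getElem_of_mem ((h5 x).2 hx)
    exact ⟨i, hi, by rw [hp i hi, h]⟩
  have hA : ∀ i, i + 1 < N → G.Adj (p i) (p (i+1)) := by
    intro i hi
    rw [hp i (by omega), hp (i+1) hi]
    exact List.isChain_iff_getElem.1 h1 i hi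
  have hN0 : G.Adj (p (N-1)) (p 0) := by
    have e1 : p 0 = a := by
      rw [hp 0 (by omega)]
      rw [List.head?_eq_getElem?, List.getElem?_eq_getElem (by omega)] at h3
      simpa using h3
    have e2 : p (N-1) = b := by
      rw [hp (N-1) (by omega)]
      rw [List.getLast?_eq_getElem?, List.getElem?_eq_getElem (by omega)] at h4
      simpa using h4
    rw [e1, e2]; exact hab
  set P := S.image m with hP
  have hPc : P.card ≤ S.card := Finset.card_image_le
  let B1 := (Finset.Ico 2 (N-1)).filter (fun t => p (t-1) ∈ P)
  let B2 := (Finset.Ico 2 (N-1)).filter (fun t => p t ∈ P)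
  have hB1 : B1.card ≤ P.card := by
    apply Finset.card_le_card_of_injOn (fun t => p (t-1))
    · intro t ht
      exact (Finset.mem_filter.1 ht).2
    · intro t ht t' ht' h
      have q1 := Finset.mem_Ico.1 (Finset.mem_filter.1 ht).1
      have q2 := Finset.mem_Ico.1 (Finset.mem_filter.1 ht').1
      have := hpinj _ _ (by omega) (by omega) h
      omega
  have hB2 : B2.card ≤ P.card := by
    apply Finset.card_le_card_of_injOn (fun t => p t)
    · intro t ht
      exact (Finset.mem_filter.1 ht).2
    · intro t ht t' ht' h
      have q1 := Finset.mem_Ico.1 (Finset.mem_filter.1 ht).1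
      have q2 := Finset.mem_Ico.1 (Finset.mem_filter.1 ht').1
      exact hpinj _ _ (by omega) (by omega) h
  let W := Finset.Ico 2 (N-1) \ (B1 ∪ B2)
  have hWc : 2 * k^2 + k < W.card := by
    have e1 := Finset.le_card_sdiff (B1 ∪ B2) (Finset.Ico 2 (N-1))
    have e2 := Finset.card_union_le B1 B2
    rw [Nat.card_Ico] at e1
    change _ ≤ W.card at e1
    omega
  obtain ⟨t, htW, a', b', hpath, hba⟩ := position (A := fun x y => G.Adj (p x) (p y)) (N := N)
    (k := k) (by omega) (fun x y h => h.symm) hA hN0 (by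
      intro F hF hFi
      have hi : Set.InjOn p (F : Set ℕ) := fun x hx y hy h => hpinj x y (hF x hx) (hF y hy) h
      rw [← Finset.card_image_of_injOn hi]
      apply hk
      intro x hx y hy hxy
      obtain ⟨i, hi, rfl⟩ := Finset.mem_image.1 hx
      obtain ⟨j, hj, rfl⟩ := Finset.mem_image.1 hy
      exact hFi i hi j hj (fun h => hxy (by rw [h]))) W (by
      intro t ht
      exact Finset.mem_Ico.1 (Finset.mem_sdiff.1 ht).1) hWc
  obtain ⟨ht1, ht2⟩ := Finset.mem_sdiff.1 htW
  have ht3 := Finset.mem_Ico.1 ht1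
  rw [Finset.mem_union, not_or] at ht2
  have hx1 : p (t-1) ∉ P := fun h => ht2.1 (Finset.mem_filter.2 ⟨ht1, h⟩)
  have hx2 : p t ∉ P := fun h => ht2.2 (Finset.mem_filter.2 ⟨ht1, h⟩)
  have hxS : p (t-1) ∉ S := hpS _ (by omega)
  have hyS : p t ∉ S := hpS _ (by omega)
  have hadj : G.Adj (p (t-1)) (p t) := by
    have := hA (t-1) (by omega)
    rwa [Nat.sub_add_cancel (by omega)] at this
  have hmP : ∀ x ∈ S, m x ∈ P := fun x hx => Finset.mem_image_of_mem _ hx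
  refine ⟨insert (p (t-1)) S, fun x => if x = p (t-1) then p t else m x,
    Finset.card_insert_of_notMem hxS, ⟨p a', p b', ?_, hba⟩, ?_, ?_⟩
  · refine hpath.map p ?_ ?_
    · intro x y hx hy h
      exact hpinj x y hx.1 hy.1 h
    · intro z
      rw [Finset.mem_insert, not_or]
      constructor
      · rintro ⟨hz1, hz2⟩
        obtain ⟨i, hi, rfl⟩ := hpsurj z hz2
        exact ⟨i, ⟨hi, fun h => hz1 (by rw [h])⟩, rfl⟩
      · rintro ⟨i, ⟨hi, hi2⟩, rfl⟩
        exact ⟨fun h => hi2 (hpinj _ _ hi (by omega) h), hpS i hi⟩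
  · intro x hx
    by_cases hxe : x = p (t-1)
    · subst hxe
      simp only [if_true, Finset.mem_insert, not_or]
      exact ⟨⟨hadj.ne', hyS⟩, hadj⟩
    · have hxS' : x ∈ S := (Finset.mem_insert.1 hx).resolve_left hxe
      simp only [if_neg hxe, Finset.mem_insert, not_or]
      exact ⟨⟨fun h => hx1 (h ▸ hmP x hxS'), (hm x hxS').1⟩, (hm x hxS').2⟩
  · intro x hx y hy hxy
    by_cases hxe : x = p (t-1)
    · have hye : y ≠ p (t-1) := fun h => hxy (hxe.trans h.symm)
      have hyS' : y ∈ S := (Finset.mem_insert.1 hy).resolve_left hye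
      simp only [if_pos hxe, if_neg hye]
      exact fun h => hx2 (h ▸ hmP y hyS')
    · have hxS' : x ∈ S := (Finset.mem_insert.1 hx).resolve_left hxe
      by_cases hye : y = p (t-1)
      · simp only [if_neg hxe, if_pos hye]
        exact fun h => hx2 (h ▸ hmP x hxS')
      · have hyS' : y ∈ S := (Finset.mem_insert.1 hy).resolve_left hye
        simp only [if_neg hxe, if_neg hye]
        exact hinj x hxS' y hyS' hxy

theorem iter_step {V : Type} [Fintype V] [DecidableEq V] {G : SimpleGraph V} {k : ℕ}
    (hk : IndepNumLE G k) (hH : IsHamiltonianGraph G) (s : ℕ)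
    (hcard : 2 * k^2 + k + 3 * s + 4 ≤ Fintype.card V) : ∀ j, j ≤ s →
    ∃ (S' : Finset V) (m' : V → V), S'.card = j ∧ CycOn G (fun x => x ∉ S') ∧
      (∀ x ∈ S', m' x ∉ S' ∧ G.Adj x (m' x)) ∧
      (∀ x ∈ S', ∀ y ∈ S', x ≠ y → m' x ≠ m' y) := by
  intro j
  induction j with
  | zero =>
    intro _
    obtain ⟨v, c, hc, hall⟩ := hH
    refine ⟨∅, id, rfl, ?_, by simp, by simp⟩
    have := cycOn_of_walk c hc
    simpa [hall] using this
  | succ j ih =>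
    intro hj
    obtain ⟨S, m, h1, h2, h3, h4⟩ := ih (by omega)
    obtain ⟨S', m', g1, g2⟩ := one_step hk S m h2 h3 h4 (by omega)
    exact ⟨S', m', by omega, g2⟩

/-- Partition of a Hamiltonian graph into a cycle C and a set S of size ⌊εn/20⌋ together
with a matching from S into C covering S. -/
theorem stmt7 :
    ∃ ε₀ : ℝ, 0 < ε₀ ∧ ∀ ε : ℝ, 0 < ε → ε < ε₀ →
      ∃ k₀ : ℕ, ∀ k : ℕ, k₀ ≤ k →
        ∀ (V : Type) [Fintype V] (G : SimpleGraph V),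
          IsHamiltonianGraph G → IndepNumLE G k →
          (2 + ε) * (k : ℝ) ^ 2 ≤ (Fintype.card V : ℝ) →
          ∃ (v : V) (c : G.Walk v v) (S : Finset V) (m : V → V),
            c.IsCycle ∧
            (∀ x : V, x ∈ c.support ↔ x ∉ S) ∧
            S.card = ⌊ε * (Fintype.card V : ℝ) / 20⌋₊ ∧
            (∀ x ∈ S, m x ∈ c.support ∧ G.Adj x (m x)) ∧
            (∀ x ∈ S, ∀ y ∈ S, x ≠ y → m x ≠ m y) := by
  classical
  refine ⟨1, one_pos, fun ε hε hε1 => ⟨⌈10 / ε⌉₊, fun k hk V _ G hH hI hn => ?_⟩⟩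
  set n := Fintype.card V with hndef
  set s := ⌊ε * (n : ℝ) / 20⌋₊ with hsdef
  have hkR : 10 / ε ≤ (k : ℝ) := Nat.ceil_le.1 hk
  have hke : 10 ≤ ε * k := by
    rw [div_le_iff₀ hε] at hkR; linarith
  have hk10 : (10 : ℝ) ≤ k := by nlinarith
  have hs : (s : ℝ) ≤ ε * n / 20 := Nat.floor_le (by positivity)
  have hcard : 2 * k^2 + k + 3 * s + 4 ≤ n := by
    have h1 : (1 - 3 * ε / 20) * ((2 + ε) * (k : ℝ) ^ 2) ≤ (1 - 3 * ε / 20) * n :=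
      mul_le_mul_of_nonneg_left hn (by linarith)
    have h2 : 10 * (k : ℝ) ≤ ε * k * k := mul_le_mul_of_nonneg_right hke (by positivity)
    have h3 : ε * (ε * (k : ℝ)^2) ≤ 1 * (ε * (k:ℝ)^2) :=
      mul_le_mul_of_nonneg_right hε1.le (by positivity)
    have h4 : (2 * (k:ℝ)^2 + k + 3 * s + 4) ≤ n := by nlinarith
    exact_mod_cast h4
  obtain ⟨S, m, h1, h2, h3, h4⟩ := iter_step hI hH s hcard s le_rfl
  obtain ⟨v, c, hc, hsup⟩ := walk_of_cycOn h2 Sᶜ (by simp) (by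
    rw [Finset.card_compl]; omega)
  refine ⟨v, c, S, m, hc, hsup, h1, ?_, h4⟩
  intro x hx
  exact ⟨(hsup _).2 (h3 x hx).1, (h3 x hx).2⟩
end

section
/- For every integer k ≥ 2 there exists a graph G on n = 2k² − 2k vertices such that G is Hamiltonian, the independence number of G equals k, and G contains no cycle of length 2k − 1; in particular, G is not pancyclic. -/
open SimpleGraph Finset

/-- cliques of size `m` on consecutive integers, plus the Hamiltonian cycle -/
def ringG (n m : ℕ) : SimpleGraph (Fin n) where
  Adj u v := u ≠ v ∧ (u.val / m = v.val / m ∨ u.val + 1 = v.val ∨ v.val + 1 = u.val ∨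
    (u.val = 0 ∧ v.val + 1 = n) ∨ (v.val = 0 ∧ u.val + 1 = n))
  symm := ⟨by
    intro u v h
    refine ⟨h.1.symm, ?_⟩
    rcases h.2 with h | h | h | h | h
    · exact Or.inl h.symm
    all_goals tauto⟩
  loopless := ⟨fun u h => h.1 rfl⟩

def Cr (k m i : ℕ) {n : ℕ} (a b : Fin n) : Prop :=
  a.val = i * m + (m - 1) ∧ (b.val = (i + 1) * m ∨ i + 1 = k ∧ b.val = 0)

theorem cut_bridge {V : Type} (H : SimpleGraph V) (S : V → Prop) (a b : V)
    (hab : ¬ (S a ↔ S b))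
    (hS : ∀ u v, H.Adj u v → s(u, v) ≠ s(a, b) → (S u ↔ S v)) : H.IsBridge s(a, b) := by
  rw [isBridge_iff]
  rintro ⟨p⟩
  apply hab
  have key : ∀ {x y : V} (q : (H.deleteEdges {s(a, b)}).Walk x y), S x ↔ S y := by
    intro x y q
    induction q with
    | nil => exact Iff.rfl
    | cons h q ih =>
      rw [deleteEdges_adj] at h
      exact (hS _ _ h.1 (by simpa using h.2)).trans ih
  exact key p

theorem walk_same {V : Type} (G : SimpleGraph V) (f : V → ℕ) :
    ∀ {x y : V} (q : G.Walk x y), (∀ u v, s(u, v) ∈ q.edges → f u = f v) →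
      ∀ w ∈ q.support, f w = f x := by
  intro x y q
  induction q with
  | nil => intro _ w hw; simp at hw; rw [hw]
  | cons h q ih =>
    intro hq w hw
    rw [Walk.support_cons, List.mem_cons] at hw
    rcases hw with rfl | hw
    · rfl
    · rw [ih (fun u v huv => hq u v (by simp [huv])) w hw]
      exact (hq _ _ (by simp)).symm

theorem cycle_card {V : Type} [DecidableEq V] (G : SimpleGraph V) {x : V} (c : G.Walk x x)
    (hc : c.IsCycle) : c.support.toFinset.card = c.length := by
  have h1 : c.support.toFinset = c.support.tail.toFinset := by
    ext w
    simp only [List.mem_toFinset]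
    constructor
    · intro h
      rw [Walk.mem_support_iff] at h
      rcases h with rfl | h
      · exact Walk.end_mem_tail_support hc.not_nil
      · exact h
    · exact List.mem_of_mem_tail
  rw [h1, List.toFinset_card_of_nodup hc.support_nodup]
  simp

section
variable {k m n : ℕ}

theorem cr_blocks (hm : 2 ≤ m) {i : ℕ} {a b : Fin n} (hn : n = k * m) (h : Cr k m i a b) :
    a.val / m = i ∧ (b.val / m = i + 1 ∧ i + 1 < k ∨ i + 1 = k ∧ b.val / m = 0) := by
  obtain ⟨h1, h2⟩ := h
  constructor
  · rw [h1, Nat.div_eq_iff (by omega)]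
    omega
  · rcases h2 with h2 | ⟨h2, h3⟩
    · left
      have := b.2
      rw [h2, hn] at this
      refine ⟨?_, Nat.lt_of_mul_lt_mul_right this⟩
      rw [h2, Nat.mul_div_cancel _ (by omega)]
    · right; simp [h2, h3]

theorem cr_unique {i : ℕ} {a b a' b' : Fin n} (hn : n = k * m)
    (h : Cr k m i a b) (h' : Cr k m i a' b') : a = a' ∧ b = b' := by
  obtain ⟨h1, h2⟩ := h
  obtain ⟨h1', h2'⟩ := h'
  refine ⟨Fin.ext (by omega), Fin.ext ?_⟩
  have hb := b.2
  have hb' := b'.2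
  rcases h2 with h2 | ⟨h2, h3⟩ <;> rcases h2' with h2' | ⟨h2', h3'⟩
  · omega
  · subst h2'; omega
  · subst h2; omega
  · omega

theorem cr_exists (hm : 2 ≤ m) (hn : n = k * m) {i : ℕ} (hi : i < k) :
    ∃ a b : Fin n, Cr k m i a b := by
  have h0 : (i + 1) * m ≤ k * m := Nat.mul_le_mul_right _ hi
  have h1 : (i + 1) * m = i * m + m := by ring
  refine ⟨⟨i * m + (m - 1), by omega⟩, ?_⟩
  by_cases hk : i + 1 = k
  · exact ⟨⟨0, by omega⟩, rfl, Or.inr ⟨hk, rfl⟩⟩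
  · have h2 : (i + 1 + 1) * m ≤ k * m := Nat.mul_le_mul_right _ (by omega)
    have h3 : (i + 1 + 1) * m = (i + 1) * m + m := by ring
    exact ⟨⟨(i + 1) * m, by omega⟩, rfl, Or.inl rfl⟩

theorem cr_adj (hk : 2 ≤ k) (hm : 2 ≤ m) (hn : n = k * m) {i : ℕ} {a b : Fin n}
    (h : Cr k m i a b) : (ringG n m).Adj a b := by
  have hb := cr_blocks hm hn h
  refine ⟨?_, ?_⟩
  · rintro rfl
    omega
  · obtain ⟨h1, h2⟩ := h
    have h3 : (i + 1) * m = i * m + m := by ring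
    rcases h2 with h2 | ⟨h2, h4⟩
    · right; left; omega
    · subst h2
      right; right; right; right; omega

theorem succ_cr (hm : 2 ≤ m) (hn : n = k * m) {u v : Fin n} (h : u.val + 1 = v.val) :
    u.val / m = v.val / m ∨ ∃ i < k, Cr k m i u v := by
  by_cases hq : u.val / m = v.val / m
  · exact Or.inl hq
  right
  have e1 := Nat.div_add_mod u.val m
  have e2 := Nat.mod_lt u.val (show 0 < m by omega)
  have hu : u.val / m < k := by
    rw [Nat.div_lt_iff_lt_mul (by omega), ← hn]; exact u.2
  have e3 : u.val % m = m - 1 := by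
    by_contra hne
    apply hq
    symm
    rw [Nat.div_eq_iff (by omega), Nat.mul_comm]
    omega
  refine ⟨u.val / m, hu, ?_, Or.inl ?_⟩
  · rw [Nat.mul_comm]; omega
  · rw [Nat.add_mul, Nat.mul_comm]; omega

theorem last_cr (hk : 2 ≤ k) (hm : 2 ≤ m) (hn : n = k * m) {u v : Fin n} (h : v.val = 0)
    (h' : u.val + 1 = n) : ∃ i < k, Cr k m i u v := by
  obtain ⟨j, rfl⟩ : ∃ j, k = j + 1 := ⟨k - 1, by omega⟩
  refine ⟨j, by omega, ?_, Or.inr ⟨rfl, h⟩⟩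
  rw [Nat.add_mul] at hn
  omega

theorem adj_cases (hk : 2 ≤ k) (hm : 2 ≤ m) (hn : n = k * m) {u v : Fin n}
    (h : (ringG n m).Adj u v) :
    u.val / m = v.val / m ∨ ∃ i < k, (Cr k m i u v ∨ Cr k m i v u) := by
  rcases h.2 with h | h | h | h | h
  · exact Or.inl h
  · rcases succ_cr hm hn h with h | ⟨i, hi, h⟩
    · exact Or.inl h
    · exact Or.inr ⟨i, hi, Or.inl h⟩
  · rcases succ_cr hm hn h with h | ⟨i, hi, h⟩
    · exact Or.inl h.symm
    · exact Or.inr ⟨i, hi, Or.inr h⟩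
  · obtain ⟨i, hi, h⟩ := last_cr hk hm hn h.1 h.2
    exact Or.inr ⟨i, hi, Or.inr h⟩
  · obtain ⟨i, hi, h⟩ := last_cr hk hm hn h.1 h.2
    exact Or.inr ⟨i, hi, Or.inl h⟩

theorem cut_iff (hm : 2 ≤ m) (hn : n = k * m) {i j l : ℕ} {u v : Fin n}
    (hi : l ≠ i) (hj : l ≠ j) (h : Cr k m l u v) (hi' : i < k) (hj' : j < k) :
    ((min i j < u.val / m ∧ u.val / m ≤ max i j) ↔
      (min i j < v.val / m ∧ v.val / m ≤ max i j)) := by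
  have := cr_blocks hm hn h
  omega

theorem all_cross (hk : 2 ≤ k) (hm : 2 ≤ m) (hn : n = k * m) {i j : ℕ} {a b a' b' : Fin n}
    (hi : i < k) (hj : j < k)
    (h : Cr k m i a b) (h' : Cr k m j a' b') {x : Fin n} (c : (ringG n m).Walk x x)
    (hc : c.IsCycle) (hab : s(a, b) ∈ c.edges) : s(a', b') ∈ c.edges := by
  by_contra hno
  have hij : i ≠ j := by
    rintro rfl
    obtain ⟨rfl, rfl⟩ := cr_unique hn h h'
    exact hno hab
  have hd : ∀ e ∈ c.edges, e ∉ ({s(a', b')} : Set (Sym2 (Fin n))) := by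
    rintro e he rfl
    exact hno he
  have hbr : ((ringG n m).deleteEdges {s(a', b')}).IsBridge s(a, b) := by
    apply cut_bridge _ (fun w : Fin n => min i j < w.val / m ∧ w.val / m ≤ max i j)
    · have := cr_blocks hm hn h
      omega
    · intro u v huv hne
      rw [deleteEdges_adj] at huv
      have hne' : s(u, v) ≠ s(a', b') := by simpa using huv.2
      rcases adj_cases hk hm hn huv.1 with h1 | ⟨l, hl, h1 | h1⟩
      · simp only [h1]
      · refine cut_iff hm hn ?_ ?_ h1 hi hj
        · rintro rfl
          obtain ⟨rfl, rfl⟩ := cr_unique hn h h1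
          exact hne rfl
        · rintro rfl
          obtain ⟨rfl, rfl⟩ := cr_unique hn h' h1
          exact hne' rfl
      · refine (cut_iff hm hn ?_ ?_ h1 hi hj).symm
        · rintro rfl
          obtain ⟨rfl, rfl⟩ := cr_unique hn h h1
          exact hne Sym2.eq_swap
        · rintro rfl
          obtain ⟨rfl, rfl⟩ := cr_unique hn h' h1
          exact hne' Sym2.eq_swap
  have h2 := hbr.notMem_edges_of_isCycle (Walk.IsCycle.toDeleteEdges (ringG n m) _ hc hd)
  apply h2
  simpa [Walk.toDeleteEdges, Walk.edges_transfer] using hab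

theorem block_card (hm : 2 ≤ m) (q : ℕ) (s : Finset (Fin n))
    (hs : ∀ w ∈ s, w.val / m = q) : s.card ≤ m := by
  rw [← Finset.card_range m]
  apply Finset.card_le_card_of_injOn (fun w => w.val % m)
  · intro w _
    simpa using Nat.mod_lt _ (by omega)
  · intro w hw w' hw' he
    have e1 := Nat.div_add_mod w.val m
    have e2 := Nat.div_add_mod w'.val m
    rw [hs w hw] at e1
    rw [hs w' hw'] at e2
    simp only at he
    exact Fin.ext (by omega)

theorem cycle_len (hk : 2 ≤ k) (hm : 2 ≤ m) (hn : n = k * m) {x : Fin n}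
    (c : (ringG n m).Walk x x) (hc : c.IsCycle) : c.length ≤ m ∨ 2 * k ≤ c.length := by
  classical
  rw [← cycle_card _ c hc]
  by_cases hall : ∀ i < k, ∀ a b : Fin n, Cr k m i a b → s(a, b) ∈ c.edges
  · right
    have hl : ∀ i < k, ∃ a ∈ c.support, a.val = i * m + (m - 1) := by
      intro i hi
      obtain ⟨a, b, h⟩ := cr_exists hm hn hi
      exact ⟨a, Walk.fst_mem_support_of_mem_edges _ (hall i hi a b h), h.1⟩
    have hf : ∀ i < k, ∃ a ∈ c.support, a.val = i * m + 0 := by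
      intro i hi
      rcases i with _ | i
      · obtain ⟨a, b, h⟩ := cr_exists hm hn (show k - 1 < k by omega)
        refine ⟨b, Walk.snd_mem_support_of_mem_edges _ (hall _ (by omega) a b h), ?_⟩
        have hb := b.2
        rcases h.2 with h2 | h2
        · rw [h2, Nat.sub_add_cancel (by omega)] at hb
          omega
        · simp [h2.2]
      · obtain ⟨a, b, h⟩ := cr_exists hm hn (show i < k by omega)
        refine ⟨b, Walk.snd_mem_support_of_mem_edges _ (hall _ (by omega) a b h), ?_⟩
        rcases h.2 with h2 | h2
        · simpa using h2
        · omega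
    have hsub : (((Finset.range k) ×ˢ ({0, m - 1} : Finset ℕ)).image
        (fun p => p.1 * m + p.2)) ⊆ c.support.toFinset.image Fin.val := by
      intro w hw
      simp only [Finset.mem_image, Finset.mem_product, Finset.mem_range, Finset.mem_insert,
        Finset.mem_singleton] at hw
      obtain ⟨⟨i, r⟩, ⟨hi, hr⟩, rfl⟩ := hw
      simp only [Finset.mem_image, List.mem_toFinset]
      rcases hr with hr | hr
      · simp only at hr; subst hr; exact hf i hi
      · simp only at hr; subst hr; exact hl i hi
    have hcard := Finset.card_le_card hsub
    rw [Finset.card_image_of_injOn, Finset.card_product, Finset.card_range,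
      Finset.card_pair (by omega)] at hcard
    · have := Finset.card_image_le (s := c.support.toFinset) (f := Fin.val)
      omega
    · rintro ⟨i, r⟩ hp ⟨i', r'⟩ hp' he
      simp only [Finset.coe_product, Set.mem_prod, Finset.mem_coe, Finset.mem_insert,
        Finset.mem_singleton] at hp hp'
      simp only at he
      have hr : r < m := by omega
      have hr' : r' < m := by omega
      have h1 : i = i' := by
        have e1 : (i * m + r) / m = i := by rw [Nat.div_eq_iff (by omega)]; omega
        have e2 : (i' * m + r') / m = i' := by rw [Nat.div_eq_iff (by omega)]; omega
        rw [← e1, he, e2]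
      subst h1
      simp only [Prod.mk.injEq, true_and]
      omega
  · left
    push Not at hall
    obtain ⟨i, hi, a, b, hab, hno⟩ := hall
    have hnone : ∀ j < k, ∀ a' b' : Fin n, Cr k m j a' b' → s(a', b') ∉ c.edges := by
      intro j hj a' b' h' hmem
      exact hno (all_cross hk hm hn hj hi h' hab c hc hmem)
    apply block_card hm (x.val / m)
    intro w hw
    rw [List.mem_toFinset] at hw
    refine walk_same _ (fun v : Fin n => v.val / m) c ?_ w hw
    intro u v huv
    rcases adj_cases hk hm hn (c.adj_of_mem_edges huv) with h | ⟨j, hj, h | h⟩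
    · exact h
    · exact absurd huv (hnone j hj _ _ h)
    · rw [Sym2.eq_swap] at huv
      exact absurd huv (hnone j hj _ _ h)

theorem ring_ham (h3 : 3 ≤ n) : IsHamiltonianGraph (ringG n m) := by
  obtain ⟨r, rfl⟩ : ∃ r, n = r + 3 := ⟨n - 3, by omega⟩
  have hle : cycleGraph (r + 3) ≤ ringG (r + 3) m := by
    intro u v h
    refine ⟨h.ne, Or.inr ?_⟩
    rw [cycleGraph_adj'] at h
    have hu := u.2
    have hv := v.2
    have key : ∀ x y : Fin (r + 3), (x - y).val = 1 →
        x.val = y.val + 1 ∨ (x.val = 0 ∧ y.val + 1 = r + 3) := by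
      intro x y hxy
      have hx := x.2
      have hy := y.2
      rcases le_or_gt y x with hle | hlt
      · rw [Fin.sub_val_of_le hle] at hxy
        omega
      · rw [Fin.coe_sub_iff_lt.2 hlt] at hxy
        rw [Fin.lt_def] at hlt
        omega
    rcases h with h | h
    · have := key _ _ h; omega
    · have := key _ _ h; omega
  refine ⟨0, (cycleGraph.cycle r).mapLe hle, ?_, ?_⟩
  · rw [Walk.isCycle_mapLe]
    exact cycleGraph.isCycle_cycle
  · intro u
    rw [Walk.support_mapLe_eq_support]
    classical
    have := cycle_card _ _ (cycleGraph.isCycle_cycle (n := r))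
    rw [cycleGraph.length_cycle] at this
    have h4 : (cycleGraph.cycle r).support.toFinset = Finset.univ := by
      rw [← Finset.card_eq_iff_eq_univ, this]; simp
    rw [← List.mem_toFinset, h4]
    simp

theorem ring_indep_le (hm : 2 ≤ m) (hn : n = k * m) : IndepNumLE (ringG n m) k := by
  intro s hs
  rw [← Finset.card_range k]
  apply Finset.card_le_card_of_injOn (fun w => w.val / m)
  · intro w _
    simp only [Finset.coe_range, Set.mem_Iio]
    rw [Nat.div_lt_iff_lt_mul (by omega), ← hn]; exact w.2
  · intro w hw w' hw' he
    by_contra hne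
    exact hs w hw w' hw' hne ⟨hne, Or.inl he⟩

theorem ring_indep_ex (hk : 2 ≤ k) (hm : 2 ≤ m) (hn : n = k * m) : ∃ s : Finset (Fin n),
    (∀ x ∈ s, ∀ y ∈ s, x ≠ y → ¬ (ringG n m).Adj x y) ∧ s.card = k := by
  classical
  have hlt : ∀ i : Fin k, i.val * m < n := fun i => by
    rw [hn]; exact Nat.mul_lt_mul_of_pos_right i.2 (by omega)
  refine ⟨(Finset.univ : Finset (Fin k)).image (fun i => ⟨i.val * m, hlt i⟩), ?_, ?_⟩
  · intro x hx y hy hxy hadj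
    simp only [Finset.mem_image, Finset.mem_univ, true_and] at hx hy
    obtain ⟨i, rfl⟩ := hx
    obtain ⟨j, rfl⟩ := hy
    have key : ∀ (p q : ℕ), p * m ≠ q * m + (m - 1) := by
      intro p q h
      have h1 : (p * m) % m = 0 := Nat.mul_mod_left _ _
      rw [h, Nat.mul_add_mod_self_right, Nat.mod_eq_of_lt (by omega)] at h1
      omega
    rcases adj_cases hk hm hn hadj with h | ⟨l, hl, h | h⟩
    · simp only [Nat.mul_div_cancel _ (show 0 < m by omega)] at h
      apply hxy
      simp [h]
    · exact key _ _ h.1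
    · exact key _ _ h.1
  · rw [Finset.card_image_of_injective, Finset.card_univ, Fintype.card_fin]
    intro i j h
    simp only [Fin.mk.injEq] at h
    exact Fin.ext (Nat.eq_of_mul_eq_mul_right (by omega) h)

end

/-- The extremal construction: for every k ≥ 2 there is a Hamiltonian graph on
n = 2k² - 2k vertices with independence number exactly k and no cycle of length 2k - 1;
in particular it is not pancyclic. -/
theorem stmt9 (k : ℕ) (hk : 2 ≤ k) :
    ∃ G : SimpleGraph (Fin (2 * k ^ 2 - 2 * k)),
      IsHamiltonianGraph G ∧
      IndepNumLE G k ∧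
      (∃ s : Finset (Fin (2 * k ^ 2 - 2 * k)),
        (∀ x ∈ s, ∀ y ∈ s, x ≠ y → ¬ G.Adj x y) ∧ s.card = k) ∧
      ¬ HasCycleLength G (2 * k - 1) ∧
      ¬ Pancyclic G := by
  
  have hn : 2 * k ^ 2 - 2 * k = k * (2 * k - 2) := by
    rw [Nat.mul_sub]; congr 1 <;> ring
  have hm : 2 ≤ 2 * k - 2 := by omega
  have hbig : 2 * (2 * k - 2) ≤ k * (2 * k - 2) := Nat.mul_le_mul_right _ hk
  have hno : ¬ HasCycleLength (ringG (2 * k ^ 2 - 2 * k) (2 * k - 2)) (2 * k - 1) := by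
    rintro ⟨v, c, hc, hl⟩
    have := cycle_len hk hm hn c hc
    omega
  refine ⟨ringG _ (2 * k - 2), ring_ham (by omega), ring_indep_le hm hn,
    ring_indep_ex hk hm hn, hno, ?_⟩
  intro hp
  apply hno
  apply hp
  · omega
  · rw [Fintype.card_fin]; omega
end

section
/- Let G be a graph, let t ≥ 2 be an integer, and let P = (x₀, x₁, …, x_N) be a path in G, whose vertices are ordered x₀ < x₁ < ⋯ < x_N along P. Suppose that the induced subgraph G[V(P)] contains no increasing path of length t having x_N as an endpoint which is an induced subgraph of G[V(P)]. Then in G[V(P)] the pair (x₀, x_N) is t-dense in the interval [0, N], i.e., for all reals a' ≤ b' with 0 ≤ a', b' ≤ N and b' − a' ≥ t, there is an integer ℓ ∈ [a', b'] and a path of length ℓ in G[V(P)] with endpoints x₀ and x_N. -/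
open SimpleGraph Finset

theorem aux_shortcut {V : Type} {G : SimpleGraph V} {x y : V} (q : G.Walk x y)
    (k m : ℕ) (hkm : k < m) (hm : m ≤ q.length) (h : G.Adj (q.getVert k) (q.getVert m)) :
    ∃ r : G.Walk x y, r.support.Sublist q.support ∧ r.length + m = q.length + k + 1 := by
  refine ⟨(q.take k).append (Walk.cons h (q.drop m)), ?_, ?_⟩
  · rw [Walk.support_append, Walk.support_cons, List.tail_cons, Walk.support_take,
      Walk.drop_support_eq_support_drop_min, Nat.min_eq_left hm]
    have h1 : (q.support.drop m).Sublist (q.support.drop (k + 1)) :=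
      List.drop_sublist_drop_left _ hkm
    have h2 := List.Sublist.append (List.Sublist.refl (q.support.take (k + 1))) h1
    rwa [List.take_append_drop] at h2
  · simp only [Walk.length_append, Walk.length_cons, Walk.take_length, Walk.drop_length]
    omega

theorem aux_step {V : Type} [LinearOrder V] {G : SimpleGraph V}
    (t : ℕ) {x y : V} (S : List V)
    (hnoind : ¬ ∃ (a : V) (q : G.Walk a y), q.IsPath ∧ q.length = t ∧
        q.support.Pairwise (· < ·) ∧ (∀ w ∈ q.support, w ∈ S) ∧
        (∀ u ∈ q.support, ∀ w ∈ q.support, G.Adj u w → s(u, w) ∈ q.edges))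
    (q : G.Walk x y) (hq : q.support.Pairwise (· < ·)) (hS : ∀ w ∈ q.support, w ∈ S)
    (hl : t ≤ q.length) :
    ∃ r : G.Walk x y, r.support.Sublist q.support ∧ r.length < q.length ∧
      q.length < r.length + t := by
  by_contra hcon
  apply hnoind
  have hsub : (q.drop (q.length - t)).support.Sublist q.support := by
    rw [Walk.drop_support_eq_support_drop_min]
    exact List.drop_sublist _ _
  have hpw := hq.sublist hsub
  have hlen : (q.drop (q.length - t)).length = t := by
    rw [Walk.drop_length]; omega
  refine ⟨_, q.drop (q.length - t), ?_, hlen, hpw, fun w hw => hS w (hsub.subset hw), ?_⟩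
  · rw [Walk.isPath_def]
    exact hpw.imp (fun h => ne_of_lt h)
  have key : ∀ i j, i < j → j ≤ t →
      G.Adj (q.getVert (q.length - t + i)) (q.getVert (q.length - t + j)) → j = i + 1 := by
    intro i j hij hj hadj
    by_contra hne
    obtain ⟨r, hr, hrl⟩ := aux_shortcut q _ _ (by omega) (by omega) hadj
    exact hcon ⟨r, hr, by omega, by omega⟩
  intro u hu w hw huw
  rw [Walk.mem_support_iff_exists_getVert] at hu hw
  obtain ⟨i, rfl, hi⟩ := hu
  obtain ⟨j, rfl, hj⟩ := hw
  rw [Walk.mk_mem_edges_iff_exists]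
  rw [hlen] at hi hj ⊢
  rcases lt_trichotomy i j with hij | hij | hij
  · have := key i j hij hj (by simpa using huw)
    subst this
    exact ⟨i, by omega, rfl⟩
  · subst hij
    exact absurd huw (G.irrefl)
  · have := key j i hij hi (by simpa using huw.symm)
    subst this
    exact ⟨j, by omega, Sym2.eq_swap⟩

theorem aux_main {V : Type} [LinearOrder V] {G : SimpleGraph V}
    (t : ℕ) {x y : V} (S : List V)
    (hnoind : ¬ ∃ (a : V) (q : G.Walk a y), q.IsPath ∧ q.length = t ∧
        q.support.Pairwise (· < ·) ∧ (∀ w ∈ q.support, w ∈ S) ∧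
        (∀ u ∈ q.support, ∀ w ∈ q.support, G.Adj u w → s(u, w) ∈ q.edges)) (c : ℕ) (n : ℕ) :
    ∀ (q : G.Walk x y), q.length = n → q.support.Pairwise (· < ·) → (∀ w ∈ q.support, w ∈ S) →
    c ≤ q.length →
    ∃ r : G.Walk x y, r.IsPath ∧ (∀ w ∈ r.support, w ∈ S) ∧ c ≤ r.length ∧
      (r.length < c + t ∨ r.length = c) := by
  induction n using Nat.strong_induction_on with
  | _ n ih =>
    intro q hn hq hS hc
    by_cases h : q.length < c + t
    · refine ⟨q, ?_, hS, hc, Or.inl h⟩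
      rw [Walk.isPath_def]
      exact hq.imp (fun h => ne_of_lt h)
    · obtain ⟨r, hr, h1, h2⟩ := aux_step t S hnoind q hq hS (by omega)
      exact ih r.length (by omega) r rfl (hq.sublist hr) (fun w hw => hS w (hr.subset hw))
        (by omega)

/-- If a path P = (x₀ < x₁ < ⋯ < x_N) (vertices increasing along P) is such that G[V(P)]
contains no induced increasing path of length t ending at x_N, then the pair (x₀, x_N)
is t-dense in [0, N] in G[V(P)]. -/
theorem stmt10 (V : Type) [LinearOrder V] (G : SimpleGraph V)
    (t : ℕ) (ht : 2 ≤ t) (x y : V) (p : G.Walk x y) (hp : p.IsPath)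
    (hmono : p.support.Chain' (· < ·))
    (hnoind : ¬ ∃ (a : V) (q : G.Walk a y), q.IsPath ∧ q.length = t ∧
        q.support.Chain' (· < ·) ∧ (∀ w ∈ q.support, w ∈ p.support) ∧
        (∀ u ∈ q.support, ∀ w ∈ q.support, G.Adj u w → s(u, w) ∈ q.edges)) :
    ∀ a' b' : ℝ, 0 ≤ a' → b' ≤ (p.length : ℝ) → (t : ℝ) ≤ b' - a' →
      ∃ ℓ : ℕ, a' ≤ (ℓ : ℝ) ∧ (ℓ : ℝ) ≤ b' ∧
        ∃ q : G.Walk x y, q.IsPath ∧ q.length = ℓ ∧ ∀ w ∈ q.support, w ∈ p.support := by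
  intro a' b' ha hb hab
  have hmono' : p.support.Pairwise (· < ·) := List.isChain_iff_pairwise.1 hmono
  have ht' : (2 : ℝ) ≤ t := by exact_mod_cast ht
  have hc1 := Nat.ceil_lt_add_one ha
  have hc2 := Nat.le_ceil a'
  have hc : ⌈a'⌉₊ ≤ p.length := by
    have : (⌈a'⌉₊ : ℝ) ≤ p.length := by linarith
    exact_mod_cast this
  obtain ⟨r, hr, hS, h1, h2⟩ := aux_main t p.support (by
    rintro ⟨a, q, h1, h2, h3, h4⟩
    exact hnoind ⟨a, q, h1, h2, List.isChain_iff_pairwise.2 h3, h4⟩) ⌈a'⌉₊ _ p rfl hmono'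
    (fun w hw => hw) hc
  have h3 : r.length + 1 ≤ ⌈a'⌉₊ + t := by omega
  have h1' : (⌈a'⌉₊ : ℝ) ≤ r.length := by exact_mod_cast h1
  have h3' : (r.length : ℝ) + 1 ≤ ⌈a'⌉₊ + t := by exact_mod_cast h3
  exact ⟨r.length, by linarith, by linarith, r, hr, rfl, hS⟩
end
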